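/- Let Δ be a fundamental discriminant and r ∈ ℤ with Δ ≡ r² (mod 4N). For (M,φ) ∈ Mp₂(ℤ) with M = [[a,b],[c,d]], the ℂ[K'/K]-valued function Ξ(τ,μ,α,β) = Σ_{h∈K'/K} ξ_h(τ,μ,α,β) 𝔢_h satisfies Ξ(Mτ, μ, aα+bβ, cα+dβ) = φ(τ)·ρ̃_K(M,φ)·Ξ(τ,μ,α,β), where ρ̃_K = ρ_K if Δ > 0 and ρ̃_K = ρ̄_K if Δ < 0. -/

import Mathlib

noncomputable section

open Complex
open scoped Classical Manifold

/-- `e(x) = exp(2πix)`. -/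
def e (x : ℂ) : ℂ := Complex.exp (2 * (Real.pi : ℂ) * Complex.I * x)

/-- `D` is a fundamental discriminant: either `D ≡ 1 (mod 4)` and squarefree, or
`D = 4m` with `m ≡ 2, 3 (mod 4)` squarefree. -/
def IsFundamentalDiscriminant (D : ℤ) : Prop :=
  (D % 4 = 1 ∧ Squarefree D) ∨
    (D % 4 = 0 ∧ Squarefree (D / 4) ∧ (D / 4 % 4 = 2 ∨ D / 4 % 4 = 3))

/-- The Kronecker symbol `(a/2)`. -/
def kron2 (a : ℤ) : ℤ :=
  if a % 2 = 0 then 0 else if a % 8 = 1 ∨ a % 8 = 7 then 1 else -1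

/-- The Kronecker symbol `(a/n)`, extending the Jacobi symbol to arbitrary integers `n`. -/
def kronecker (a n : ℤ) : ℤ :=
  if n = 0 then (if a = 1 ∨ a = -1 then 1 else 0)
  else
    (if n < 0 ∧ a < 0 then -1 else 1) * kron2 a ^ n.natAbs.factorization 2 *
      jacobiSym a (n.natAbs / 2 ^ n.natAbs.factorization 2)

/-- The discriminant `b² - 4Nac` of the integral binary quadratic form `[a, b, Nc]`
corresponding to the lattice vector `λ = [[b/2N, -a/N], [c, -b/2N]] ∈ L'`;
note `Q(λ) = (b² - 4Nac)/(4N)`. -/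
def QD (N : ℕ) (a b c : ℤ) : ℤ := b ^ 2 - 4 * (N : ℤ) * a * c

/-- The condition under which the generalized genus character `χ_Δ` is non-zero at `[a, b, Nc]`:
`Δ ∣ b² - 4Nac`, `(b² - 4Nac)/Δ` is a square modulo `4N`, and `gcd(a, b, c, Δ) = 1`. -/
def GenusCharCond (N : ℕ) (Δ a b c : ℤ) : Prop :=
  Δ ∣ QD N a b c ∧ (∃ s : ℤ, QD N a b c / Δ ≡ s ^ 2 [ZMOD (4 * (N : ℤ))]) ∧
    Int.gcd (Int.gcd (Int.gcd a b) c) Δ = 1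

/-- `χ` (with `χ a b c` meaning `χ_Δ` applied to the vector of `L'` corresponding to the
binary quadratic form `[a, b, Nc]`) is the generalized genus character `χ_Δ` of
Gross–Kohnen–Zagier: it only depends on the argument modulo `ΔL`, it vanishes unless
`GenusCharCond` holds, and in that case it equals the Kronecker symbol `(Δ/n)` for any
integer `n` prime to `Δ` represented by one of the forms `[N₁a, b, N₂c]` with
`N₁N₂ = N`, `N₁, N₂ > 0`. -/
def IsGenusChar (N : ℕ) (Δ : ℤ) (χ : ℤ → ℤ → ℤ → ℤ) : Prop :=
  (∀ a b c a' b' c' : ℤ,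
      a ≡ a' [ZMOD Δ] → b ≡ b' [ZMOD (2 * (N : ℤ) * Δ)] → c ≡ c' [ZMOD Δ] →
      χ a b c = χ a' b' c') ∧
  (∀ a b c : ℤ, ¬ GenusCharCond N Δ a b c → χ a b c = 0) ∧
  (∀ a b c n : ℤ, GenusCharCond N Δ a b c → Int.gcd n Δ = 1 →
      (∃ N₁ N₂ x y : ℤ, N₁ * N₂ = (N : ℤ) ∧ 0 < N₁ ∧ 0 < N₂ ∧
        n = N₁ * a * x ^ 2 + b * x * y + N₂ * c * y ^ 2) →
      χ a b c = kronecker Δ n)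

/-- The component `ξ_h(τ, μ, α, β)` of the theta function `Ξ(τ, μ, α, β)`, written out for
the lattice `K = ℤ[[1,0],[0,-1]]` (so `K'/K ≅ ℤ/2Nℤ`, `λ ∈ K'` has coordinate `k ∈ ℤ`
with `Q(λ) = k²/4N`), `ℓ = [[0,1/N],[0,0]]` and `ℓ' = [[0,0],[1,0]]`, and
`μ ∈ K ⊗ ℝ ≅ ℝ`:
`ξ_h(τ,μ,α,β) = ∑_{λ ∈ K + rh} ∑_{t (Δ), Q(λ-βℓ'+tℓ) ≡ ΔQ(h) (Δ)} χ_Δ(λ-βℓ'+tℓ)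
  e(-αt/|Δ|) e((λ+βμ)²τ/(2|Δ|) - (λ+βμ/2, αμ)/|Δ|)`.
Here `λ - βℓ' + tℓ` corresponds to the form `[-t, k, -Nβ]` (coordinates `(-t, k, -β)`). -/
def xiComp (N : ℕ) (Δ r : ℤ) (χ : ℤ → ℤ → ℤ → ℤ) (μ : ℝ) (α β : ℤ)
    (h : ZMod (2 * N)) (τ : UpperHalfPlane) : ℂ :=
  ∑' k : ℤ,
    if k ≡ r * (h.val : ℤ) [ZMOD (2 * (N : ℤ))] then
      (∑ t ∈ Finset.range Δ.natAbs,
        if k ^ 2 - 4 * (N : ℤ) * (t : ℤ) * β ≡ Δ * (h.val : ℤ) ^ 2 [ZMOD (4 * (N : ℤ) * Δ)] then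
          (χ (-(t : ℤ)) k (-β) : ℂ) * e (-(α : ℂ) * (t : ℂ) / (Δ.natAbs : ℂ))
        else 0) *
        e ((N : ℂ) * ((k : ℂ) / (2 * (N : ℂ)) + (β : ℂ) * (μ : ℂ)) ^ 2 * (τ : ℂ) / (Δ.natAbs : ℂ) -
           (α : ℂ) * (μ : ℂ) * ((k : ℂ) + (N : ℂ) * (β : ℂ) * (μ : ℂ)) / (Δ.natAbs : ℂ))
    else 0

/-- An element of the metaplectic group `Mp₂(ℤ)`: a pair `(M, φ)` where
`M ∈ SL₂(ℤ)` and `φ : ℍ → ℂ` is holomorphic with `φ(τ)² = cτ + d`. -/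
structure Mp2 where
  M : Matrix.SpecialLinearGroup (Fin 2) ℤ
  φ : UpperHalfPlane → ℂ
  hol : MDifferentiable 𝓘(ℂ) 𝓘(ℂ) φ
  sq : ∀ τ : UpperHalfPlane, φ τ ^ 2 = (M.1 1 0 : ℂ) * (τ : ℂ) + (M.1 1 1 : ℂ)

theorem Mp2.ext_of {γ δ : Mp2} (hM : γ.M = δ.M) (hφ : ∀ τ, γ.φ τ = δ.φ τ) : γ = δ := by
  cases γ; cases δ
  obtain rfl : _ = _ := hM
  obtain rfl : _ = _ := funext hφ
  rfl

theorem mdifferentiable_sl2_smul (g : Matrix.SpecialLinearGroup (Fin 2) ℤ) :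
    MDifferentiable 𝓘(ℂ) 𝓘(ℂ) (fun τ : UpperHalfPlane => g • τ) :=
  UpperHalfPlane.mdifferentiable_smul (g := (g : GL (Fin 2) ℝ)) (by simp)

theorem coe_sl2_smul (g : Matrix.SpecialLinearGroup (Fin 2) ℤ) (τ : UpperHalfPlane) :
    ((g • τ : UpperHalfPlane) : ℂ) =
      ((g.1 0 0 : ℂ) * τ + (g.1 0 1 : ℂ)) / ((g.1 1 0 : ℂ) * τ + (g.1 1 1 : ℂ)) := by
  rw [UpperHalfPlane.coe_specialLinearGroup_apply]
  simp

/-- The product in the metaplectic group. -/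
def Mp2.mul (γ δ : Mp2) : Mp2 where
  M := γ.M * δ.M
  φ := fun τ => γ.φ (δ.M • τ) * δ.φ τ
  hol := (γ.hol.comp (mdifferentiable_sl2_smul δ.M)).mul δ.hol
  sq := fun τ => by
    have hd : (δ.M.1 1 0 : ℂ) * τ + (δ.M.1 1 1 : ℂ) ≠ 0 := by
      have := UpperHalfPlane.denom_ne_zero (δ.M : GL (Fin 2) ℝ) τ
      simpa [UpperHalfPlane.denom] using this
    rw [mul_pow, γ.sq, δ.sq, coe_sl2_smul]
    simp only [Matrix.SpecialLinearGroup.coe_mul, Matrix.mul_apply, Fin.sum_univ_two]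
    push_cast
    rw [add_mul, mul_assoc, div_mul_cancel₀ _ hd]
    ring

/-- The standard lift of `T`. -/
def Mp2.T : Mp2 where
  M := ModularGroup.T
  φ := fun _ => 1
  hol := mdifferentiable_const
  sq := fun τ => by simp [ModularGroup.T]

/-- The standard lift of `S`. -/
def Mp2.S : Mp2 where
  M := ModularGroup.S
  φ := fun τ => (τ : ℂ) ^ (1 / 2 : ℂ)
  hol := by
    rw [UpperHalfPlane.mdifferentiable_iff]
    have : DifferentiableOn ℂ (fun z : ℂ => z ^ (1 / 2 : ℂ)) {z : ℂ | 0 < z.im} := by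
      intro z hz
      exact (DifferentiableAt.cpow_const differentiableAt_id
        (Or.inr (ne_of_gt hz))).differentiableWithinAt
    refine this.congr fun z hz => ?_
    simp only [Function.comp_apply, UpperHalfPlane.ofComplex_apply_of_im_pos hz]
  sq := fun τ => by
    rw [← Complex.cpow_nat_mul]
    simp [ModularGroup.S]

theorem cpow_half_neg_inv_mul {z : ℂ} (hz : 0 < z.im) :
    (-z⁻¹) ^ (1 / 2 : ℂ) * z ^ (1 / 2 : ℂ) = I := by
  have hz0 : z ≠ 0 := by rintro rfl; simp at hz
  have hlog : Complex.log (-z) = Complex.log z - Real.pi * I := by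
    apply Complex.ext
    · simp [Complex.log_re]
    · simp [Complex.log_im, Complex.arg_neg_eq_arg_sub_pi_of_im_pos hz]
  have harg : (-z).arg ≠ Real.pi := by
    rw [Complex.arg_neg_eq_arg_sub_pi_of_im_pos hz]
    have := Complex.arg_le_pi z
    have := Real.pi_pos
    linarith
  rw [← inv_neg, Complex.cpow_def_of_ne_zero (by simpa using hz0), Complex.cpow_def_of_ne_zero hz0,
    Complex.log_inv _ harg, hlog, ← Complex.exp_add]
  rw [show -(log z - Real.pi * I) * (1 / 2) + log z * (1 / 2) = Real.pi / 2 * I by ring]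
  exact Complex.exp_pi_div_two_mul_I

theorem Mp2.eq_or_neg {γ δ : Mp2} (hM : γ.M = δ.M) :
    (∀ τ, γ.φ τ = δ.φ τ) ∨ (∀ τ, γ.φ τ = -δ.φ τ) := by
  have h : (γ.φ - δ.φ) * (γ.φ + δ.φ) = 0 := by
    funext τ
    have h1 := γ.sq τ
    have h2 := δ.sq τ
    rw [hM, ← h2] at h1
    simp only [Pi.mul_apply, Pi.sub_apply, Pi.add_apply, Pi.zero_apply]
    linear_combination h1
  rcases (UpperHalfPlane.mul_eq_zero_iff (γ.hol.sub δ.hol) (γ.hol.add δ.hol)).1 h with h | h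
  · left; intro τ; have := congrFun h τ
    simp only [Pi.sub_apply, Pi.zero_apply] at this
    linear_combination this
  · right; intro τ; have := congrFun h τ
    simp only [Pi.add_apply, Pi.zero_apply] at this
    linear_combination this

/-- A property of metaplectic elements that is stable under products and holds for the standard
lifts of `S` and `T` holds everywhere. -/
theorem Mp2.induction_on_generators (P : Mp2 → Prop)
    (hmul : ∀ γ δ, P γ → P δ → P (γ.mul δ)) (hT : P Mp2.T) (hS : P Mp2.S) (γ : Mp2) : P γ := by
  let W : Submonoid (Matrix.SpecialLinearGroup (Fin 2) ℤ) :=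
    { carrier := {M | ∃ γ : Mp2, γ.M = M ∧ P γ}
      mul_mem' := by
        rintro _ _ ⟨γ, rfl, h1⟩ ⟨δ, rfl, h2⟩
        exact ⟨γ.mul δ, rfl, hmul _ _ h1 h2⟩
      one_mem' := by
        refine ⟨(Mp2.S.mul Mp2.S).mul (Mp2.S.mul Mp2.S), ?_,
          hmul _ _ (hmul _ _ hS hS) (hmul _ _ hS hS)⟩
        change (ModularGroup.S * ModularGroup.S) * (ModularGroup.S * ModularGroup.S) = 1
        ext i j
        fin_cases i <;> fin_cases j <;> rfl }
  have hWS : ModularGroup.S ∈ W := ⟨_, rfl, hS⟩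
  have hWT : ModularGroup.T ∈ W := ⟨_, rfl, hT⟩
  have hSinv : ModularGroup.S⁻¹ = ModularGroup.S * ModularGroup.S * ModularGroup.S := by
    ext i j
    fin_cases i <;> fin_cases j <;> rfl
  have hTinv : ModularGroup.T⁻¹ = ModularGroup.S * ModularGroup.S * ModularGroup.S *
      ModularGroup.T * ModularGroup.S * ModularGroup.T * ModularGroup.S := by
    ext i j
    fin_cases i <;> fin_cases j <;> rfl
  have htop : W = ⊤ := by
    rw [eq_top_iff, ← Subgroup.top_toSubmonoid, ← SpecialLinearGroup.SL2Z_generators,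
      Subgroup.closure_toSubmonoid, Submonoid.closure_le]
    rintro M (hM | hM)
    · rcases hM with rfl | rfl
      · exact hWS
      · exact hWT
    · rcases hM with hM | hM
      · rw [inv_eq_iff_eq_inv] at hM
        rw [hM, hSinv]
        exact W.mul_mem (W.mul_mem hWS hWS) hWS
      · rw [Set.mem_singleton_iff, inv_eq_iff_eq_inv] at hM
        rw [hM, hTinv]
        exact W.mul_mem (W.mul_mem (W.mul_mem (W.mul_mem (W.mul_mem (W.mul_mem hWS hWS) hWS) hWT)
          hWS) hWT) hWS
  obtain ⟨δ, hδM, hδ⟩ : γ.M ∈ W := by rw [htop]; trivial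
  rcases Mp2.eq_or_neg hδM with h | h
  · rwa [← Mp2.ext_of hδM h]
  · set Z := (Mp2.S.mul Mp2.S).mul (Mp2.S.mul Mp2.S) with hZ
    have hZP : P Z := hmul _ _ (hmul _ _ hS hS) (hmul _ _ hS hS)
    have hSS : ∀ τ, (Mp2.S.mul Mp2.S).φ τ = I := by
      intro τ
      change ((ModularGroup.S • τ : UpperHalfPlane) : ℂ) ^ (1 / 2 : ℂ) * (τ : ℂ) ^ (1 / 2 : ℂ) = I
      rw [← cpow_half_neg_inv_mul τ.im_pos, coe_sl2_smul]
      simp [ModularGroup.S, neg_div]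
    have hZφ : ∀ τ, Z.φ τ = -1 := by
      intro τ
      change (Mp2.S.mul Mp2.S).φ _ * (Mp2.S.mul Mp2.S).φ τ = -1
      rw [hSS, hSS, I_mul_I]
    have hZM : Z.M = 1 := by
      change (ModularGroup.S * ModularGroup.S) * (ModularGroup.S * ModularGroup.S) = 1
      ext i j
      fin_cases i <;> fin_cases j <;> rfl
    have : γ = Z.mul δ := by
      refine Mp2.ext_of ?_ fun τ => ?_
      · change γ.M = Z.M * δ.M
        rw [hZM, one_mul, hδM]
      · change γ.φ τ = Z.φ _ * δ.φ τ
        rw [hZφ, h]; ring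
    rw [this]
    exact hmul _ _ hZP hδ

theorem e_add (x y : ℂ) : e (x + y) = e x * e y := by
  simp only [e, ← Complex.exp_add]; ring_nf

theorem e_int (n : ℤ) : e n = 1 := by
  rw [e, Complex.exp_eq_one_iff]; exact ⟨n, by ring⟩

theorem e_neg (x : ℂ) : e (-x) = (e x)⁻¹ := by
  simp only [e, ← Complex.exp_neg]; ring_nf

theorem e_ne_zero (x : ℂ) : e x ≠ 0 := Complex.exp_ne_zero _

theorem e_add_int (x : ℂ) (n : ℤ) : e (x + n) = e x := by rw [e_add, e_int, mul_one]

theorem e_eq_of_sub_int {x y : ℂ} (n : ℤ) (h : x = y + n) : e x = e y := by rw [h, e_add_int]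

theorem jacobiTheta₂_term_eq_e (n : ℤ) (z τ : ℂ) :
    jacobiTheta₂_term n z τ = e (n * z + n ^ 2 * τ / 2) := by
  rw [jacobiTheta₂_term, e]; ring_nf

/-- The theta series attached to a weight function `F` of period `M`. -/
def thetaSum (M : ℕ) (F : ℤ → ℂ) (a b τ : ℂ) : ℂ :=
  ∑' k : ℤ, F k * e ((k + b) ^ 2 * τ / (2 * M) - a * k / M - a * b / (2 * M))

/-- The contribution of one residue class to a theta series. -/
def thetaClass (M : ℕ) (a b τ : ℂ) (k : ℤ) : ℂ :=
  e ((k + b) ^ 2 * τ / (2 * M) - a * k / M - a * b / (2 * M)) *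
    jacobiTheta₂ ((k + b) * τ - a) (M * τ)

theorem periodic_add_mul {F : ℤ → ℂ} {M : ℤ} (hF : ∀ k, F (k + M) = F k) (k n : ℤ) :
    F (k + M * n) = F k := by
  have : Function.Periodic F M := hF
  rw [mul_comm]
  simpa using this.int_mul n k

theorem hasSum_thetaSum {M : ℕ} (hM : 0 < M) {F : ℤ → ℂ} (hF : ∀ k, F (k + M) = F k) (a b : ℂ)
    {τ : ℂ} (hτ : 0 < τ.im) :
    HasSum (fun k : ℤ => F k * e ((k + b) ^ 2 * τ / (2 * M) - a * k / M - a * b / (2 * M)))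
      (∑ k ∈ Finset.range M, F k * thetaClass M a b τ k) := by
  have hM0 : (M : ℂ) ≠ 0 := by exact_mod_cast hM.ne'
  have hMτ : 0 < ((M : ℂ) * τ).im := by
    rw [← Complex.ofReal_natCast, Complex.im_ofReal_mul]
    exact mul_pos (by exact_mod_cast hM) hτ
  set t : ℤ → ℂ := fun k => e ((k + b) ^ 2 * τ / (2 * M) - a * k / M - a * b / (2 * M)) with ht
  have key : ∀ k0 : ℕ, HasSum (fun k : ℤ => if k % M = (k0 : ℤ) % M then t k else 0)
      (thetaClass M a b τ k0) := by
    intro k0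
    have hinj : Function.Injective (fun n : ℤ => (k0 : ℤ) + M * n) := by
      intro m n h
      simpa [hM.ne'] using h
    rw [← hinj.hasSum_iff]
    · have h1 := (hasSum_jacobiTheta₂_term ((((k0 : ℤ) : ℂ) + b) * τ - a) hMτ).mul_left
        (e ((((k0 : ℤ) : ℂ) + b) ^ 2 * τ / (2 * M) - a * ((k0 : ℤ) : ℂ) / M - a * b / (2 * M)))
      refine h1.congr_fun ?_
      intro n
      simp only [Function.comp_apply, Int.add_mul_emod_self_left, if_true, ht,
        jacobiTheta₂_term_eq_e]
      rw [← e_add]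
      refine congrArg e ?_
      push_cast
      field_simp
      ring
    · intro k hk
      rw [if_neg]
      intro h
      apply hk
      refine ⟨(k - k0) / M, ?_⟩
      have : (M : ℤ) ∣ k - k0 := Int.ModEq.dvd (Int.ModEq.symm h)
      simp only
      rw [Int.mul_ediv_cancel' this]; ring
  have h2 := hasSum_sum (s := Finset.range M) fun k0 _ => (key k0).mul_left (F k0)
  refine h2.congr_fun ?_
  intro k
  have hk0 : 0 ≤ k % M := Int.emod_nonneg _ (by exact_mod_cast hM.ne')
  have hk1 : k % M < M := Int.emod_lt_of_pos _ (by exact_mod_cast hM)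
  obtain ⟨j, hj⟩ := Int.eq_ofNat_of_zero_le hk0
  have hjM : j < M := by rw [hj] at hk1; exact_mod_cast hk1
  rw [Finset.sum_eq_single j]
  · rw [if_pos (by rw [← hj]; simp), ← hj]
    congr 1
    conv_lhs => rw [← Int.emod_add_mul_ediv k M]
    exact periodic_add_mul hF _ _
  · intro i hi hij
    rw [if_neg, mul_zero]
    rw [Finset.mem_range] at hi
    rw [hj, Int.emod_eq_of_lt (by positivity) (by exact_mod_cast hi)]
    exact_mod_cast hij.symm
  · intro h
    exact absurd (Finset.mem_range.2 hjM) h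

theorem thetaSum_eq {M : ℕ} (hM : 0 < M) {F : ℤ → ℂ} (hF : ∀ k, F (k + M) = F k) (a b : ℂ)
    {τ : ℂ} (hτ : 0 < τ.im) :
    thetaSum M F a b τ = ∑ k ∈ Finset.range M, F k * thetaClass M a b τ k :=
  (hasSum_thetaSum hM hF a b hτ).tsum_eq

/-- The finite Fourier transform of a weight function of period `M`. -/
def fourierPer (M : ℕ) (F : ℤ → ℂ) (k' : ℤ) : ℂ :=
  ∑ k ∈ Finset.range M, F k * e (-(k * k') / M)

theorem fourierPer_periodic {M : ℕ} (hM : 0 < M) (F : ℤ → ℂ) (k : ℤ) :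
    fourierPer M F (k + M) = fourierPer M F k := by
  have hM0 : (M : ℂ) ≠ 0 := by exact_mod_cast hM.ne'
  refine Finset.sum_congr rfl fun j _ => ?_
  congr 1
  refine e_eq_of_sub_int (-j) ?_
  push_cast
  field_simp
  ring

theorem cpow_half_real_mul {x : ℝ} (hx : 0 < x) (z : ℂ) :
    ((x : ℂ) * z) ^ (1 / 2 : ℂ) = (Real.sqrt x : ℂ) * z ^ (1 / 2 : ℂ) := by
  rcases eq_or_ne z 0 with rfl | hz
  · simp
  rw [Complex.cpow_def_of_ne_zero (mul_ne_zero (by exact_mod_cast hx.ne') hz),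
    Complex.cpow_def_of_ne_zero hz, Complex.log_ofReal_mul hx hz, add_mul, Complex.exp_add,
    Real.sqrt_eq_rpow, Complex.ofReal_cpow hx.le, Complex.cpow_def_of_ne_zero
    (by exact_mod_cast hx.ne'), Complex.ofReal_log hx.le]
  norm_num

/-- Poisson summation for theta series with periodic weights. -/
theorem thetaSum_neg_inv {M : ℕ} (hM : 0 < M) {F : ℤ → ℂ} (hF : ∀ k, F (k + M) = F k) (a b : ℂ)
    {τ : ℂ} (hτ : 0 < τ.im) :
    thetaSum M F (-b) a (-1 / τ) =
      (-I * τ) ^ (1 / 2 : ℂ) / (Real.sqrt M : ℂ) * thetaSum M (fourierPer M F) a b τ := by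
  have hM0 : (M : ℂ) ≠ 0 := by exact_mod_cast hM.ne'
  have hMr : (0 : ℝ) < M := by exact_mod_cast hM
  have hτ0 : τ ≠ 0 := by rintro rfl; simp at hτ
  have hτ' : 0 < (-1 / τ).im := by
    rw [neg_div, one_div, Complex.neg_im, Complex.inv_im]
    have := Complex.normSq_pos.2 hτ0
    rw [neg_div, neg_neg]; positivity
  have hτM : 0 < (τ / M).im := by
    rw [← Complex.ofReal_natCast, Complex.div_ofReal_im]; positivity
  have hpow : (-I * (τ / M)) ^ (1 / 2 : ℂ) = (-I * τ) ^ (1 / 2 : ℂ) / (Real.sqrt M : ℂ) := by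
    have h1 : (-I * τ : ℂ) = (M : ℝ) * (-I * (τ / M)) := by
      push_cast
      field_simp
    have h2 : (Real.sqrt M : ℂ) ≠ 0 := by
      exact_mod_cast (Real.sqrt_pos.2 hMr).ne'
    rw [eq_div_iff h2, h1, cpow_half_real_mul hMr, mul_comm]
  rw [thetaSum_eq hM hF _ _ hτ']
  have hcl : ∀ k : ℤ, thetaClass M (-b) a (-1 / τ) k =
      (-I * τ) ^ (1 / 2 : ℂ) / (Real.sqrt M : ℂ) *
        ∑' n : ℤ, e (-(k * n) / M) *
          e ((n + b) ^ 2 * τ / (2 * M) - a * n / M - a * b / (2 * M)) := by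
    intro k
    have hfe := jacobiTheta₂_functional_equation ((-(k + a) + b * τ) / M) (τ / M)
    have hne : (-I * (τ / M)) ^ (1 / 2 : ℂ) ≠ 0 := by
      rw [Ne, Complex.cpow_eq_zero_iff]
      rintro ⟨h, -⟩
      simp [hτ0, hM0] at h
    have h1 : ((-(k + a) + b * τ) / M : ℂ) / (τ / M) = (k + a) * (-1 / τ) - -b := by
      field_simp
      ring
    have h2 : (-1 : ℂ) / (τ / M) = M * (-1 / τ) := by field_simp
    rw [h1, h2] at hfe
    have h3 : jacobiTheta₂ ((k + a) * (-1 / τ) - -b) (M * (-1 / τ)) =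
        (-I * (τ / M)) ^ (1 / 2 : ℂ) * e (((-(k + a) + b * τ) / M) ^ 2 / (τ / M) / 2) *
          jacobiTheta₂ ((-(k + a) + b * τ) / M) (τ / M) := by
      rw [hfe]
      have : cexp (-Real.pi * I * ((-(k + a) + b * τ) / M) ^ 2 / (τ / M)) =
          (e (((-(k + a) + b * τ) / M) ^ 2 / (τ / M) / 2))⁻¹ := by
        rw [← e_neg, e]; congr 1; ring
      rw [this]
      have := e_ne_zero (((-(k + a) + b * τ) / M) ^ 2 / (τ / M) / 2)
      rw [← mul_assoc, mul_mul_mul_comm, mul_one_div_cancel hne, mul_inv_cancel₀ this,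
        one_mul, one_mul]
    rw [thetaClass, h3, hpow, ← mul_assoc, mul_left_comm, mul_assoc, mul_assoc]
    congr 1
    rw [← mul_assoc, ← e_add, (hasSum_jacobiTheta₂_term _ hτM).tsum_eq.symm, ← tsum_mul_left]
    refine tsum_congr fun n => ?_
    rw [jacobiTheta₂_term_eq_e, ← e_add, ← e_add]
    refine congrArg e ?_
    field_simp
    ring
  have hsummable : ∀ k : ℤ, Summable fun n : ℤ =>
      e (-(k * n) / M) * e ((n + b) ^ 2 * τ / (2 * M) - a * n / M - a * b / (2 * M)) := by
    intro k
    refine (hasSum_thetaSum hM (F := fun n : ℤ => e (-(k * n) / M)) ?_ a b hτ).summable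
    intro n
    refine e_eq_of_sub_int (-k) ?_
    push_cast
    field_simp
    ring
  simp_rw [hcl]
  rw [thetaSum]
  simp_rw [fourierPer, Finset.sum_mul]
  rw [Summable.tsum_finsetSum, Finset.mul_sum]
  · refine Finset.sum_congr rfl fun k _ => ?_
    rw [mul_left_comm, ← tsum_mul_left]
    congr 1
    refine tsum_congr fun n => ?_
    simp [mul_assoc]
  · intro k _
    simpa [mul_assoc] using (hsummable k).mul_left (F k)

/-- The finite weight of `k` in the component `h` of the theta function. -/
def weight (N : ℕ) (Δ r : ℤ) (χ : ℤ → ℤ → ℤ → ℤ) (α β h k : ℤ) : ℂ :=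
  if k ≡ r * h [ZMOD (2 * (N : ℤ))] then
    (∑ t ∈ Finset.range Δ.natAbs,
      if k ^ 2 - 4 * (N : ℤ) * (t : ℤ) * β ≡ Δ * h ^ 2 [ZMOD (4 * (N : ℤ) * Δ)] then
        (χ (-(t : ℤ)) k (-β) : ℂ) * e (-(α : ℂ) * (t : ℂ) / (Δ.natAbs : ℂ))
      else 0)
  else 0

theorem IsFundamentalDiscriminant.ne_zero {Δ : ℤ} (hΔ : IsFundamentalDiscriminant Δ) : Δ ≠ 0 := by
  rintro rfl
  rcases hΔ with h | h
  · simp at h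
  · simp at h

theorem natAbs_eq_sign_mul (Δ : ℤ) : (Δ.natAbs : ℤ) = Δ.sign * Δ := by
  rw [Int.sign_mul_self_eq_natAbs]

theorem sign_mul_sign {Δ : ℤ} (h : Δ ≠ 0) : Δ.sign * Δ.sign = 1 := by
  rcases lt_or_gt_of_ne h with h | h
  · simp [Int.sign_eq_neg_one_of_neg h]
  · simp [Int.sign_eq_one_of_pos h]

theorem modEq_congr_left {n a a' b : ℤ} (h : n ∣ a - a') :
    a ≡ b [ZMOD n] ↔ a' ≡ b [ZMOD n] := by
  have h1 : a' ≡ a [ZMOD n] := Int.modEq_iff_dvd.2 h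
  exact ⟨h1.trans, h1.symm.trans⟩

theorem eq_sign_mul_natAbs {Δ : ℤ} (hΔ : Δ ≠ 0) : (Δ : ℂ) = Δ.sign * Δ.natAbs := by
  have : Δ = Δ.sign * (Δ.natAbs : ℤ) := by
    rw [natAbs_eq_sign_mul, ← mul_assoc, sign_mul_sign hΔ, one_mul]
  calc (Δ : ℂ) = ((Δ.sign * (Δ.natAbs : ℤ) : ℤ) : ℂ) := by rw [← this]
    _ = _ := by rw [Int.cast_mul, Int.cast_natCast]

theorem weight_periodic {N : ℕ} {Δ r : ℤ} {χ : ℤ → ℤ → ℤ → ℤ}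
    (hχ : IsGenusChar N Δ χ) (α β h k : ℤ) :
    weight N Δ r χ α β h (k + (2 * N * Δ.natAbs : ℕ)) = weight N Δ r χ α β h k := by
  have hM : ((2 * N * Δ.natAbs : ℕ) : ℤ) = 2 * N * (Δ.sign * Δ) := by
    push_cast; rw [← natAbs_eq_sign_mul, Int.natCast_natAbs]
  rw [hM, weight, weight]
  congr 1
  · exact propext (modEq_congr_left ⟨Δ.sign * Δ, by ring⟩)
  · refine Finset.sum_congr rfl fun t _ => ?_
    congr 1
    · exact propext (modEq_congr_left ⟨Δ.sign * k + N * Δ.sign * Δ.sign * Δ, by ring⟩)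
    · rw [hχ.1 (-t) (k + 2 * N * (Δ.sign * Δ)) (-β) (-t) k (-β) rfl _ rfl]
      exact (Int.modEq_iff_dvd.2 ⟨Δ.sign, by ring⟩).symm

theorem xiComp_eq_thetaSum {N : ℕ} (hN : 0 < N) {Δ : ℤ} (hΔ : Δ ≠ 0) (r : ℤ)
    (χ : ℤ → ℤ → ℤ → ℤ) (μ : ℝ) (α β : ℤ) (h : ZMod (2 * N)) (τ : UpperHalfPlane) :
    xiComp N Δ r χ μ α β h τ =
      thetaSum (2 * N * Δ.natAbs) (weight N Δ r χ α β h.val) (2 * N * α * μ) (2 * N * β * μ) τ := by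
  have hN0 : (N : ℂ) ≠ 0 := by exact_mod_cast hN.ne'
  have hD0 : (Δ.natAbs : ℂ) ≠ 0 := by simpa using hΔ
  rw [xiComp, thetaSum]
  refine tsum_congr fun k => ?_
  rw [weight, ite_mul, zero_mul]
  congr 2
  refine congrArg e ?_
  push_cast
  field_simp
  ring

theorem cpow_half_neg_I_mul {z : ℂ} (hz : 0 < z.im) :
    (-I * z) ^ (1 / 2 : ℂ) = z ^ (1 / 2 : ℂ) * e (-(1 / 8)) := by
  have hz0 : z ≠ 0 := by rintro rfl; simp at hz
  have harg : 0 < z.arg := by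
    rcases (Complex.arg_nonneg_iff.2 hz.le).lt_or_eq with h | h
    · exact h
    · rw [eq_comm, Complex.arg_eq_zero_iff] at h
      exact absurd h.2 hz.ne'
  have hlog : Complex.log (-I * z) = Complex.log z - Real.pi / 2 * I := by
    rw [Complex.log_mul_eq_add_log_iff (by simp) hz0 |>.2, Complex.log_neg_I]
    · ring
    · rw [Complex.arg_neg_I]
      have := Complex.arg_le_pi z
      have := Real.pi_pos
      constructor <;> linarith
  rw [Complex.cpow_def_of_ne_zero (by simpa using hz0), Complex.cpow_def_of_ne_zero hz0, hlog, e,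
    ← Complex.exp_add]
  congr 1
  ring

theorem xiComp_T {N : ℕ} (hN : 0 < N) {Δ : ℤ} (hΔ : Δ ≠ 0) (r : ℤ)
    (χ : ℤ → ℤ → ℤ → ℤ) (μ : ℝ) (α β : ℤ) (h : ZMod (2 * N)) (τ : UpperHalfPlane) :
    xiComp N Δ r χ μ (α + β) β h (ModularGroup.T • τ) =
      e ((Δ.sign : ℂ) * (h.val : ℂ) ^ 2 / (4 * (N : ℂ))) * xiComp N Δ r χ μ α β h τ := by
  have hN0 : (N : ℂ) ≠ 0 := by exact_mod_cast hN.ne'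
  have hD0 : (Δ.natAbs : ℂ) ≠ 0 := by simpa using hΔ
  have hcoe : ((ModularGroup.T • τ : UpperHalfPlane) : ℂ) = τ + 1 := by
    rw [coe_sl2_smul]; simp [ModularGroup.T]
  rw [xiComp, xiComp, ← tsum_mul_left]
  refine tsum_congr fun k => ?_
  split_ifs with hk
  · rw [Finset.sum_mul, Finset.sum_mul, Finset.mul_sum]
    refine Finset.sum_congr rfl fun t _ => ?_
    split_ifs with ht
    · obtain ⟨z, hz⟩ := ht.symm.dvd
      have hz' : ((k : ℂ) ^ 2 - 4 * N * t * β) = Δ * h.val ^ 2 + 4 * N * Δ * z := by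
        have : k ^ 2 - 4 * (N : ℤ) * t * β = Δ * (h.val : ℤ) ^ 2 + 4 * N * Δ * z := by
          linear_combination hz
        exact_mod_cast this
      have hs := eq_sign_mul_natAbs hΔ
      rw [hs] at hz'
      rw [mul_assoc ((χ (-(t : ℤ)) k (-β)) : ℂ), mul_assoc ((χ (-(t : ℤ)) k (-β)) : ℂ),
        mul_left_comm (e _), ← e_add, ← e_add, ← e_add, hcoe]
      congr 1
      refine e_eq_of_sub_int (Δ.sign * z) ?_
      push_cast
      field_simp
      linear_combination 4 * hz'
    · simp
  · simp

theorem xi_transformation_of_fourier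
    (N : ℕ) (hN : 0 < N) (Δ : ℤ) (hΔ : Δ ≠ 0)
    (r : ℤ) (χ : ℤ → ℤ → ℤ → ℤ) (hχ : IsGenusChar N Δ χ)
    (hfourier : ∀ α β h k' : ℤ,
      fourierPer (2 * N * Δ.natAbs) (weight N Δ r χ (-β) α h) k' =
        e ((1 - (Δ.sign : ℂ)) / 8) * (Real.sqrt Δ.natAbs : ℂ) *
          ∑ j ∈ Finset.range (2 * N), e (-(Δ.sign : ℂ) * h * j / (2 * N)) *
            weight N Δ r χ α β j k')
    (ρ : Mp2 → (ZMod (2 * N) → ℂ) →ₗ[ℂ] (ZMod (2 * N) → ℂ))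
    (hρmul : ∀ γ δ ζ : Mp2, ζ.M = γ.M * δ.M →
      (∀ τ : UpperHalfPlane, ζ.φ τ = γ.φ (δ.M • τ) * δ.φ τ) →
      ρ ζ = (ρ γ).comp (ρ δ))
    (hρT : ∀ γ : Mp2, γ.M = ModularGroup.T → (∀ τ, γ.φ τ = 1) →
      ∀ (v : ZMod (2 * N) → ℂ) (h : ZMod (2 * N)),
        ρ γ v h = e ((Δ.sign : ℂ) * (h.val : ℂ) ^ 2 / (4 * (N : ℂ))) * v h)
    (hρS : ∀ γ : Mp2, γ.M = ModularGroup.S →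
      (∀ τ : UpperHalfPlane, γ.φ τ = (τ : ℂ) ^ (1/2 : ℂ)) →
      ∀ (v : ZMod (2 * N) → ℂ) (h : ZMod (2 * N)),
        ρ γ v h = e (-(Δ.sign : ℂ) / 8) / (Real.sqrt (2 * N) : ℂ) *
          ∑ j ∈ Finset.range (2 * N),
            e (-(Δ.sign : ℂ) * (h.val : ℂ) * (j : ℂ) / (2 * (N : ℂ))) * v (j : ZMod (2 * N)))
    (γ : Mp2) (τ : UpperHalfPlane) (μ : ℝ) (α β : ℤ) :
      (fun h => xiComp N Δ r χ μ
          (γ.M.1 0 0 * α + γ.M.1 0 1 * β) (γ.M.1 1 0 * α + γ.M.1 1 1 * β) h (γ.M • τ)) =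
        γ.φ τ • ρ γ (fun h => xiComp N Δ r χ μ α β h τ) := by
  revert τ μ α β
  refine Mp2.induction_on_generators (fun γ => ∀ (τ : UpperHalfPlane) (μ : ℝ) (α β : ℤ),
      (fun h => xiComp N Δ r χ μ
          (γ.M.1 0 0 * α + γ.M.1 0 1 * β) (γ.M.1 1 0 * α + γ.M.1 1 1 * β) h (γ.M • τ)) =
        γ.φ τ • ρ γ (fun h => xiComp N Δ r χ μ α β h τ)) ?_ ?_ ?_ γ
  · intro γ δ hγ hδ τ μ α β
    have hM : (γ.mul δ).M = γ.M * δ.M := rfl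
    rw [hρmul γ δ (γ.mul δ) rfl fun _ => rfl, LinearMap.comp_apply, hM, mul_smul]
    have h1 := hγ (δ.M • τ) μ (δ.M.1 0 0 * α + δ.M.1 0 1 * β) (δ.M.1 1 0 * α + δ.M.1 1 1 * β)
    rw [hδ τ μ α β, map_smul] at h1
    refine Eq.trans ?_ (h1.trans (mul_smul (γ.φ (δ.M • τ)) (δ.φ τ) _).symm)
    funext h
    simp only [Matrix.SpecialLinearGroup.coe_mul, Matrix.mul_apply, Fin.sum_univ_two]
    congr 1 <;> ring_nf
  · intro τ μ α β
    funext h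
    change xiComp N Δ r χ μ (1 * α + 1 * β) (0 * α + 1 * β) h (ModularGroup.T • τ) =
      (1 : ℂ) * ρ Mp2.T (fun h => xiComp N Δ r χ μ α β h τ) h
    rw [hρT Mp2.T rfl fun _ => rfl, one_mul, one_mul, one_mul, zero_mul, zero_add,
      xiComp_T hN hΔ]
  · intro τ μ α β
    funext h
    change xiComp N Δ r χ μ (0 * α + (-1) * β) (1 * α + 0 * β) h (ModularGroup.S • τ) =
      (τ : ℂ) ^ (1 / 2 : ℂ) * ρ Mp2.S (fun h => xiComp N Δ r χ μ α β h τ) h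
    have hcoe : ((ModularGroup.S • τ : UpperHalfPlane) : ℂ) = -1 / τ := by
      rw [coe_sl2_smul]; simp [ModularGroup.S]
    have hD : 0 < Δ.natAbs := Int.natAbs_pos.2 hΔ
    have hM : 0 < 2 * N * Δ.natAbs := by positivity
    have : NeZero (2 * N) := ⟨by omega⟩
    rw [hρS Mp2.S rfl fun _ => rfl, xiComp_eq_thetaSum hN hΔ, hcoe]
    have e1 : (0 * α + (-1) * β) = -β := by ring
    have e2 : (1 * α + 0 * β) = α := by ring
    rw [e1, e2]
    have e3 : (2 * N * ((-β : ℤ) : ℂ) * μ) = -(2 * N * β * μ) := by push_cast; ring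
    rw [e3, thetaSum_neg_inv hM (weight_periodic hχ _ _ _) _ _ τ.im_pos,
      thetaSum_eq hM (fourierPer_periodic hM _) _ _ τ.im_pos]
    have e4 : ∀ j ∈ Finset.range (2 * N), xiComp N Δ r χ μ α β (j : ZMod (2 * N)) τ =
        ∑ k ∈ Finset.range (2 * N * Δ.natAbs), weight N Δ r χ α β j k *
          thetaClass (2 * N * Δ.natAbs) (2 * N * α * μ) (2 * N * β * μ) τ k := by
      intro j hj
      rw [xiComp_eq_thetaSum hN hΔ, ZMod.val_natCast_of_lt (Finset.mem_range.1 hj),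
        thetaSum_eq hM (weight_periodic hχ _ _ _) _ _ τ.im_pos]
    rw [Finset.sum_congr rfl fun j hj => congrArg _ (e4 j hj)]
    have hsq : (Real.sqrt (2 * N * Δ.natAbs : ℕ) : ℂ) =
        (Real.sqrt (2 * N) : ℂ) * (Real.sqrt Δ.natAbs : ℂ) := by
      rw [← Complex.ofReal_mul, ← Real.sqrt_mul (by positivity)]
      push_cast
      rfl
    have hne1 : (Real.sqrt (2 * N) : ℂ) ≠ 0 := by
      have : 0 < Real.sqrt (2 * N) := Real.sqrt_pos.2 (by positivity)
      exact_mod_cast this.ne'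
    have hne2 : (Real.sqrt Δ.natAbs : ℂ) ≠ 0 := by
      have : 0 < Real.sqrt Δ.natAbs := Real.sqrt_pos.2 (by exact_mod_cast hD)
      exact_mod_cast this.ne'
    have hee : e (-(1 / 8)) * e ((1 - (Δ.sign : ℂ)) / 8) = e (-(Δ.sign : ℂ) / 8) := by
      rw [← e_add]; congr 1; ring
    simp_rw [hfourier, cpow_half_neg_I_mul τ.im_pos]
    rw [hsq, ← hee]
    simp_rw [Finset.mul_sum, Finset.sum_mul, Finset.mul_sum]
    rw [Finset.sum_comm]
    refine Finset.sum_congr rfl fun j _ => Finset.sum_congr rfl fun k _ => ?_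
    field_simp
    push_cast
    ring_nf

theorem jacobiTheta_eq_tsum_e (τ : ℂ) : jacobiTheta τ = ∑' n : ℤ, e (n ^ 2 * τ / 2) := by
  rw [jacobiTheta]
  refine tsum_congr fun n => ?_
  rw [e]; ring_nf

theorem jacobiTheta_I_ne_zero : jacobiTheta I ≠ 0 := by
  intro h
  have h1 := norm_jacobiTheta_sub_one_le (τ := I) (by simp)
  rw [h] at h1
  simp only [zero_sub, norm_neg, norm_one, I_im, mul_one] at h1
  have h2 : Real.exp (-Real.pi) < 1 / 4 := by
    have h3 : (4 : ℝ) < Real.exp Real.pi := by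
      have := Real.add_one_lt_exp Real.pi_ne_zero
      have := Real.pi_gt_three
      linarith
    rw [Real.exp_neg, one_div]
    exact inv_strictAnti₀ (by norm_num) h3
  have h4 : 0 < 1 - Real.exp (-Real.pi) := by linarith
  rw [div_mul_eq_mul_div, le_div_iff₀ h4] at h1
  linarith

theorem jacobiTheta_neg_inv {τ : ℂ} : jacobiTheta τ =
    1 / (-I * τ) ^ (1 / 2 : ℂ) * jacobiTheta (-1 / τ) := by
  rw [jacobiTheta_eq_jacobiTheta₂, jacobiTheta_eq_jacobiTheta₂, jacobiTheta₂_functional_equation]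
  simp

theorem jacobiTheta_sub_even {m : ℕ} (τ : ℂ) : jacobiTheta (τ - (2 * m : ℕ)) = jacobiTheta τ := by
  have h : Function.Periodic jacobiTheta 2 := fun x => by rw [add_comm, jacobiTheta_two_add]
  have := h.nat_mul m (τ - (2 * m : ℕ))
  rw [← this]
  congr 1
  push_cast
  ring

/-- Invariance of a complete residue sum under translation. -/
theorem sum_range_periodic_shift {M : ℕ} {F : ℤ → ℂ} (hF : ∀ k, F (k + M) = F k) (c : ℤ) :
    ∑ k ∈ Finset.range M, F (k + c) = ∑ k ∈ Finset.range M, F k := by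
  have hnat : ∀ F : ℤ → ℂ, (∀ k, F (k + M) = F k) →
      ∑ k ∈ Finset.range M, F (k + 1) = ∑ k ∈ Finset.range M, F k := by
    intro F hF
    have h1 := Finset.sum_range_succ (fun k : ℕ => F k) M
    have h2 := Finset.sum_range_succ' (fun k : ℕ => F k) M
    have h3 : F M = F 0 := by simpa using hF 0
    simp only [Nat.cast_add, Nat.cast_one, Nat.cast_zero] at h1 h2
    rw [h1, h3] at h2
    exact (add_right_cancel h2).symm
  have key : ∀ c : ℕ, ∀ F : ℤ → ℂ, (∀ k, F (k + M) = F k) →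
      ∑ k ∈ Finset.range M, F (k + c) = ∑ k ∈ Finset.range M, F k := by
    intro c
    induction c with
    | zero => intro F _; simp
    | succ c ih =>
      intro F hF
      rw [← hnat F hF, ← ih (fun k => F (k + 1)) fun k => by rw [add_right_comm, hF]]
      refine Finset.sum_congr rfl fun k _ => ?_
      congr 1
  obtain ⟨n, rfl | rfl⟩ := c.eq_nat_or_neg
  · exact key n F hF
  · rw [← key n (fun k => F (k + -n)) fun k => by rw [add_right_comm, hF]]
    simp

theorem quadratic_exponential_sum {m : ℕ} (hm : 0 < m) :
    ∑ k ∈ Finset.range (2 * m), e ((k : ℂ) ^ 2 / (4 * m)) =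
      (Real.sqrt (2 * m : ℕ) : ℂ) * e (1 / 8) := by
  set M : ℕ := 2 * m with hMdef
  have hM : 0 < M := by positivity
  have hm0 : (m : ℂ) ≠ 0 := by exact_mod_cast hm.ne'
  have hM0 : (M : ℂ) ≠ 0 := by exact_mod_cast hM.ne'
  have hMm : (M : ℂ) = 2 * m := by rw [hMdef]; push_cast; ring
  have hMr : (0 : ℝ) < M := by exact_mod_cast hM
  set Γ : ℂ := ∑ k ∈ Finset.range M, e ((k : ℂ) ^ 2 / (4 * m)) with hΓ
  set F : ℤ → ℂ := fun k => e ((k : ℂ) ^ 2 / (4 * m)) with hFdef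
  have hF : ∀ k, F (k + M) = F k := by
    intro k
    refine e_eq_of_sub_int (k + m) ?_
    push_cast
    rw [hMm]
    field_simp
    ring
  have hfour : ∀ k' : ℤ, fourierPer M F k' = Γ * e (-(k' : ℂ) ^ 2 / (4 * m)) := by
    intro k'
    have h1 := sum_range_periodic_shift hF (-k')
    have h2 : Γ = ∑ k ∈ Finset.range M, F k := by
      refine Finset.sum_congr rfl fun k _ => ?_
      simp [hFdef]
    rw [h2, ← h1, Finset.sum_mul, fourierPer]
    refine Finset.sum_congr rfl fun k _ => ?_
    rw [← e_add, ← e_add]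
    congr 1
    push_cast
    rw [hMm]
    field_simp
    ring
  set τ : ℂ := 1 + M * I with hτdef
  have hτim : 0 < τ.im := by simpa [hτdef] using hM
  have hτ0 : τ ≠ 0 := by intro h; rw [h] at hτim; simp at hτim
  have h1 := thetaSum_neg_inv hM hF 0 0 hτim
  have h2 : thetaSum M F (-0) 0 (-1 / τ) = jacobiTheta (I / τ) := by
    rw [thetaSum, jacobiTheta_eq_tsum_e]
    refine tsum_congr fun k => ?_
    rw [← e_add]
    congr 1
    rw [hMm]
    field_simp
    rw [hτdef, hMm]
    ring
  have h3 : thetaSum M (fourierPer M F) 0 0 τ = Γ * jacobiTheta I := by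
    rw [thetaSum, jacobiTheta_eq_tsum_e, ← tsum_mul_left]
    refine tsum_congr fun k => ?_
    rw [hfour, mul_assoc, ← e_add]
    congr 2
    rw [hτdef, hMm]
    field_simp
    ring
  have h4 : jacobiTheta (I / τ) = τ ^ (1 / 2 : ℂ) * jacobiTheta I := by
    have e1 : (-1 / (I / τ)) = I - (2 * m : ℕ) := by
      push_cast
      field_simp
      rw [hτdef, hMm]
      linear_combination (-1) * I_sq
    have e2 : -I * (I / τ) = τ⁻¹ := by
      field_simp
      simp
    have harg : τ.arg ≠ Real.pi := by
      rw [Ne, Complex.arg_eq_pi_iff]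
      exact fun h => hτim.ne' h.2
    rw [jacobiTheta_neg_inv, e1, jacobiTheta_sub_even, e2, Complex.inv_cpow _ _ harg]
    simp
  rw [h2, h3, h4, cpow_half_neg_I_mul hτim] at h1
  have hτp : τ ^ (1 / 2 : ℂ) ≠ 0 := by
    rw [Ne, Complex.cpow_eq_zero_iff]
    exact fun h => hτ0 h.1
  have hsq : (Real.sqrt M : ℂ) ≠ 0 := by
    exact_mod_cast (Real.sqrt_pos.2 hMr).ne'
  have hθ := jacobiTheta_I_ne_zero
  have h8 : e (-(1 / 8)) ≠ 0 := e_ne_zero _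
  have h9 : e (1 / 8) = (e (-(1 / 8)))⁻¹ := by rw [e_neg, inv_inv]
  rw [h9]
  generalize e (-(1 / 8)) = E at *
  generalize τ ^ (1 / 2 : ℂ) = T at *
  generalize jacobiTheta I = J at *
  generalize (Real.sqrt M : ℂ) = R at *
  have h10 : T * J * (R - E * Γ) = 0 := by
    have : T * J * R = T * E * (Γ * J) := by
      rw [h1]; field_simp
    linear_combination this
  have h11 : R - E * Γ = 0 := by
    rcases mul_eq_zero.1 h10 with h | h
    · exact absurd h (mul_ne_zero hτp hθ)
    · exact h
  field_simp
  linear_combination -h11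

theorem sum_range_mul_eq (f : ℤ → ℂ) (a b : ℕ) :
    ∑ k ∈ Finset.range (a * b), f k =
      ∑ j ∈ Finset.range b, ∑ i ∈ Finset.range a, f (i + a * j) := by
  induction b with
  | zero => simp
  | succ b ih =>
    rw [Nat.mul_succ, Finset.sum_range_add, ih, Finset.sum_range_succ]
    congr 1
    refine Finset.sum_congr rfl fun i _ => ?_
    congr 1
    push_cast
    ring

theorem sum_range_mul_periodic {M : ℕ} {F : ℤ → ℂ} (hF : ∀ k, F (k + M) = F k) (n : ℕ) :
    ∑ k ∈ Finset.range (M * n), F k = n * ∑ k ∈ Finset.range M, F k := by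
  rw [sum_range_mul_eq]
  simp_rw [periodic_add_mul hF]
  simp

theorem e_natCast_mul (n : ℕ) (x : ℂ) : e (n * x) = e x ^ n := by
  rw [e, e, ← Complex.exp_nat_mul]; ring_nf

theorem e_eq_one_iff {x : ℂ} : e x = 1 ↔ ∃ n : ℤ, x = n := by
  rw [e, Complex.exp_eq_one_iff]
  have h : (2 * (Real.pi : ℂ) * I) ≠ 0 := Complex.two_pi_I_ne_zero
  constructor
  · rintro ⟨n, hn⟩
    refine ⟨n, mul_left_cancel₀ h ?_⟩
    rw [hn]; ring
  · rintro ⟨n, rfl⟩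
    exact ⟨n, by ring⟩

theorem e_div_eq_one_iff {n : ℕ} (hn : 0 < n) (c : ℤ) : e (c / n) = 1 ↔ (n : ℤ) ∣ c := by
  have hn0 : (n : ℂ) ≠ 0 := by exact_mod_cast hn.ne'
  rw [e_eq_one_iff]
  constructor
  · rintro ⟨z, hz⟩
    refine ⟨z, ?_⟩
    rw [div_eq_iff hn0] at hz
    have : (c : ℂ) = ((n * z : ℤ) : ℂ) := by rw [hz]; push_cast; ring
    exact_mod_cast this
  · rintro ⟨z, rfl⟩
    refine ⟨z, ?_⟩
    push_cast
    field_simp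

theorem sum_e_div {n : ℕ} (hn : 0 < n) (c : ℤ) :
    ∑ z ∈ Finset.range n, e (z * c / n) = if (n : ℤ) ∣ c then (n : ℂ) else 0 := by
  have hn0 : (n : ℂ) ≠ 0 := by exact_mod_cast hn.ne'
  have h1 : ∀ z : ℕ, e (z * c / n) = e (c / n) ^ z := fun z => by
    rw [← e_natCast_mul, mul_div_assoc]
  simp_rw [h1]
  split_ifs with h
  · rw [(e_div_eq_one_iff hn c).2 h]; simp
  · have h2 : e (c / n) ≠ 1 := fun h3 => h ((e_div_eq_one_iff hn c).1 h3)
    rw [geom_sum_eq h2, ← e_natCast_mul, mul_div_cancel₀ _ hn0, e_int]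
    simp

/-- Comparing a sum over `K'/K`-graded residues with a sum over a two-dimensional lattice. -/
theorem sum_graded_eq {N D : ℕ} (hN : 0 < N) (r : ℤ) (U : ℤ → ℤ → ℂ)
    (h0 : ∀ h k, ¬ k ≡ r * h [ZMOD (2 * (N : ℤ))] → U h k = 0)
    (hk : ∀ h k, U h (k + (2 * N * D : ℕ)) = U h k)
    (hh : ∀ h k, U (h + (2 * N : ℕ)) k = U h k)
    (hD : ∀ η κ, U (η + D) (r * (η + D) + 2 * N * κ) = U η (r * η + 2 * N * κ)) :
    D * ∑ h ∈ Finset.range (2 * N), ∑ k ∈ Finset.range (2 * N * D), U h k =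
      (2 * N : ℕ) * ∑ η ∈ Finset.range D, ∑ κ ∈ Finset.range D, U η (r * η + 2 * N * κ) := by
  set u : ℤ → ℂ := fun η => ∑ κ ∈ Finset.range D, U η (r * η + 2 * N * κ) with hu
  have hu1 : ∀ h : ℤ, ∑ k ∈ Finset.range (2 * N * D), U h k = u h := by
    intro h
    rw [← sum_range_periodic_shift (hk h) (r * h), sum_range_mul_eq (fun k => U h (k + r * h))]
    refine Finset.sum_congr rfl fun κ _ => ?_
    rw [Finset.sum_eq_single 0]
    · congr 1; push_cast; ring
    · intro i hi hi0
      apply h0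
      intro h1
      rw [Finset.mem_range] at hi
      have h2 := h1.symm.dvd
      have h3 : (2 * (N : ℤ)) ∣ i := by
        have h4 : (i : ℤ) = ((i : ℤ) + (2 * N : ℕ) * κ + r * h - r * h) - 2 * N * κ := by
          push_cast; ring
        rw [h4]
        exact dvd_sub h2 ⟨κ, rfl⟩
      have h4 : 2 * N ∣ i := by exact_mod_cast h3
      exact hi0 (Nat.eq_zero_of_dvd_of_lt h4 hi)
    · intro h1
      exact absurd (Finset.mem_range.2 (by positivity)) h1
  have hu2 : ∀ η, u (η + (2 * N : ℕ)) = u η := by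
    intro η
    rw [← hu1, ← hu1]
    exact Finset.sum_congr rfl fun k _ => hh _ _
  have hu3 : ∀ η, u (η + D) = u η := fun η => Finset.sum_congr rfl fun κ _ => hD _ _
  simp_rw [hu1]
  have h4 := sum_range_mul_periodic hu2 D
  have h5 := sum_range_mul_periodic hu3 (2 * N)
  rw [mul_comm D, h4] at h5
  exact h5

theorem sum_range_periodic_shift₂ {A B : ℕ} {F : ℤ → ℤ → ℂ} (hA : ∀ h k, F (h + A) k = F h k)
    (hB : ∀ h k, F h (k + B) = F h k) (a b : ℤ) :
    ∑ h ∈ Finset.range A, ∑ k ∈ Finset.range B, F (h + a) (k + b) =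
      ∑ h ∈ Finset.range A, ∑ k ∈ Finset.range B, F h k := by
  simp_rw [fun h => sum_range_periodic_shift (hB h) b]
  exact sum_range_periodic_shift (F := fun h => ∑ k ∈ Finset.range B, F h k)
    (fun h => Finset.sum_congr rfl fun k _ => hA _ _) a

theorem sum_e_neg_sign {N : ℕ} (hN : 0 < N) {Δ : ℤ} (hΔ : Δ ≠ 0) :
    ∑ h ∈ Finset.range (2 * N), e (-(Δ.sign : ℂ) * (h : ℂ) ^ 2 / (4 * N)) =
      (Real.sqrt (2 * N : ℕ) : ℂ) * e (-(Δ.sign : ℂ) / 8) := by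
  have h1 := quadratic_exponential_sum hN
  rcases lt_or_gt_of_ne hΔ with h | h
  · rw [Int.sign_eq_neg_one_of_neg h]
    simpa using h1
  · rw [Int.sign_eq_one_of_pos h]
    have hconj : ∀ x : ℝ, (starRingEnd ℂ) (e x) = e (-x) := by
      intro x
      rw [e, e, ← Complex.exp_conj]
      congr 1
      simp only [map_mul, Complex.conj_ofReal, Complex.conj_I, map_ofNat]
      ring
    have h2 := congrArg (starRingEnd ℂ) h1
    rw [map_sum, map_mul, Complex.conj_ofReal] at h2
    have h3 : (starRingEnd ℂ) (e (1 / 8)) = e (-1 / 8) := by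
      have := hconj (1 / 8)
      push_cast at this
      rw [this]; ring_nf
    rw [h3] at h2
    have h4 : ∀ k : ℕ, (starRingEnd ℂ) (e ((k : ℂ) ^ 2 / (4 * N))) =
        e (-1 * (k : ℂ) ^ 2 / (4 * N)) := by
      intro k
      have := hconj ((k : ℝ) ^ 2 / (4 * N))
      push_cast at this
      rw [this]; ring_nf
    simp_rw [h4] at h2
    simpa using h2

theorem Real.sqrt_natCast_mul_self (D : ℕ) : (Real.sqrt D : ℂ) * (Real.sqrt D : ℂ) = D := by
  rw [← Complex.ofReal_mul, Real.mul_self_sqrt (Nat.cast_nonneg D), Complex.ofReal_natCast]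

/-- The Gauss sum of a binary quadratic form of discriminant `Δ`. -/
theorem binary_gauss_sum {N : ℕ} (hN : 0 < N) {Δ r C : ℤ} (hΔ : Δ ≠ 0)
    (hC : r ^ 2 - Δ = 4 * N * C) :
    ∑ η ∈ Finset.range Δ.natAbs, ∑ κ ∈ Finset.range Δ.natAbs,
      e (((N * κ ^ 2 + r * κ * η + C * η ^ 2 : ℤ) : ℂ) / (Δ.natAbs : ℕ)) =
        e ((1 - (Δ.sign : ℂ)) / 8) * Δ.natAbs * (Real.sqrt Δ.natAbs : ℂ) := by
  have hD : 0 < Δ.natAbs := Int.natAbs_pos.2 hΔ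
  have hN0 : (N : ℂ) ≠ 0 := by exact_mod_cast hN.ne'
  have hD0 : (Δ.natAbs : ℂ) ≠ 0 := by exact_mod_cast hD.ne'
  have hs := eq_sign_mul_natAbs hΔ
  have hss : (Δ.sign : ℂ) * Δ.sign = 1 := by exact_mod_cast sign_mul_sign hΔ
  have hCc : (r : ℂ) ^ 2 - Δ = 4 * N * C := by exact_mod_cast hC
  set D := Δ.natAbs with hDdef
  set s := Δ.sign with hsdef
  set Q : ℤ → ℤ → ℂ := fun h k => e (((k : ℂ) ^ 2 - Δ * (h : ℂ) ^ 2) / (4 * N * D)) with hQ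
  set U : ℤ → ℤ → ℂ := fun h k => if k ≡ r * h [ZMOD (2 * (N : ℤ))] then Q h k else 0 with hU
  have hQk : ∀ h k, Q h (k + (2 * N * D : ℕ)) = Q h k := by
    intro h k
    refine e_eq_of_sub_int (k + N * D) ?_
    push_cast
    field_simp
    ring
  have hQh : ∀ h k, Q (h + (2 * N : ℕ)) k = Q h k := by
    intro h k
    refine e_eq_of_sub_int (-s * (h + N)) ?_
    rw [hs]
    push_cast
    field_simp
    ring
  have hQq : ∀ η κ : ℤ, U η (r * η + 2 * N * κ) =
      e (((N * κ ^ 2 + r * κ * η + C * η ^ 2 : ℤ) : ℂ) / D) := by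
    intro η κ
    rw [hU]
    simp only
    rw [if_pos (Int.modEq_iff_dvd.2 ⟨-κ, by ring⟩), hQ]
    simp only
    congr 1
    push_cast
    field_simp
    linear_combination (η : ℂ) ^ 2 * hCc
  have hgr := sum_graded_eq (D := D) hN r U (fun h k hk => if_neg hk) (by
      intro h k
      rw [hU]
      simp only
      rw [hQk]
      congr 1
      exact propext (modEq_congr_left ⟨D, by push_cast; ring⟩)) (by
      intro h k
      rw [hU]
      simp only
      rw [hQh]
      congr 1
      refine propext ?_
      rw [Int.modEq_comm, @Int.modEq_comm _ k]
      exact modEq_congr_left ⟨r, by push_cast; ring⟩) (by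
      intro η κ
      rw [hQq, hQq]
      refine e_eq_of_sub_int (r * κ + C * (2 * η + D)) ?_
      push_cast
      field_simp
      ring)
  simp_rw [hQq] at hgr
  have havg : ∑ h ∈ Finset.range (2 * N), ∑ k ∈ Finset.range (2 * N * D), Q h k =
      ∑ h ∈ Finset.range (2 * N), ∑ k ∈ Finset.range (2 * N * D), U h k := by
    have h2N : ((2 * N : ℕ) : ℂ) ≠ 0 := by push_cast; simpa using hN0
    apply mul_left_cancel₀ h2N
    have h1 : ∀ z ∈ Finset.range (2 * N),
        ∑ h ∈ Finset.range (2 * N), ∑ k ∈ Finset.range (2 * N * D), Q h k =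
          ∑ h ∈ Finset.range (2 * N), ∑ k ∈ Finset.range (2 * N * D),
            Q h k * e (z * ((s * (k - r * h) : ℤ) : ℂ) / (2 * N : ℕ)) := by
      intro z _
      rw [← sum_range_periodic_shift₂ hQh hQk (r * z) (Δ * z)]
      refine Finset.sum_congr rfl fun h _ => Finset.sum_congr rfl fun k _ => ?_
      rw [hQ]
      simp only
      rw [← e_add]
      refine e_eq_of_sub_int (-s * C * z ^ 2) ?_
      have hr2 : (r : ℂ) ^ 2 = s * D + 4 * N * C := by rw [← hs]; linear_combination hCc
      push_cast
      rw [hs]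
      field_simp
      ring_nf
      rw [hr2]
      linear_combination (-4 * (D : ℂ) ^ 2 * z ^ 2 + 4 * (D : ℂ) ^ 2 * z ^ 2) * hss
    have h2 := Finset.sum_congr rfl h1
    rw [Finset.sum_const, Finset.card_range, nsmul_eq_mul] at h2
    rw [h2, Finset.sum_comm, Finset.mul_sum]
    refine Finset.sum_congr rfl fun h _ => ?_
    rw [Finset.sum_comm, Finset.mul_sum]
    refine Finset.sum_congr rfl fun k _ => ?_
    rw [← Finset.mul_sum, sum_e_div (by positivity), hU]
    simp only
    have hiff : ((2 * N : ℕ) : ℤ) ∣ s * (k - r * h) ↔ (k : ℤ) ≡ r * h [ZMOD (2 * (N : ℤ))] := by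
      rw [Int.modEq_comm, Int.modEq_iff_dvd]
      push_cast
      constructor
      · intro h1
        have h2 := h1.mul_left s
        rwa [← mul_assoc, sign_mul_sign hΔ, one_mul] at h2
      · intro h1
        exact h1.mul_left s
    rw [if_congr hiff rfl rfl]
    split_ifs <;> ring
  have hprod : ∑ h ∈ Finset.range (2 * N), ∑ k ∈ Finset.range (2 * N * D), Q h k =
      (Real.sqrt (2 * N : ℕ) : ℂ) * e (-(s : ℂ) / 8) *
        ((Real.sqrt (2 * (N * D) : ℕ) : ℂ) * e (1 / 8)) := by
    rw [← sum_e_neg_sign hN hΔ, ← quadratic_exponential_sum (m := N * D) (by positivity),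
      Finset.sum_mul_sum, mul_assoc]
    refine Finset.sum_congr rfl fun h _ => Finset.sum_congr rfl fun k _ => ?_
    rw [hQ]
    simp only
    rw [← e_add, hs, ← hsdef]
    congr 1
    push_cast
    field_simp
    ring
  rw [← havg, hprod] at hgr
  have h2N : ((2 * N : ℕ) : ℂ) ≠ 0 := by push_cast; simpa using hN0
  apply mul_left_cancel₀ h2N
  rw [← hgr]
  have h8 : e ((1 - (s : ℂ)) / 8) = e (1 / 8) * e (-(s : ℂ) / 8) := by
    rw [← e_add]; congr 1; ring
  have hsq : (Real.sqrt (2 * (N * D) : ℕ) : ℂ) =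
      (Real.sqrt (2 * N : ℕ) : ℂ) * (Real.sqrt D : ℂ) := by
    rw [← Complex.ofReal_mul, ← Real.sqrt_mul (by positivity)]
    push_cast
    rw [mul_assoc]
  have hsq2 := Real.sqrt_natCast_mul_self (2 * N)
  rw [h8, hsq]
  linear_combination (D : ℂ) * e (-(s : ℂ) / 8) * (Real.sqrt D : ℂ) * e (1 / 8) * hsq2

/-- The function on `K'/K`-graded residues attached to a function of the norm modulo `Δ`. -/
def normWeight (N : ℕ) {D : ℕ} (Δ r : ℤ) (Φ : ZMod D → ℂ) (h k : ℤ) : ℂ :=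
  if k ≡ r * h [ZMOD (2 * (N : ℤ))] then
    Φ ((((k ^ 2 - Δ * h ^ 2) / (4 * N) : ℤ)) : ZMod D) else 0

theorem intCast_eq_of_dvd {D : ℕ} {Δ a b : ℤ} (hD : Δ.natAbs = D) (h : Δ ∣ a - b) :
    (a : ZMod D) = (b : ZMod D) := by
  rw [ZMod.intCast_eq_intCast_iff_dvd_sub]
  rw [← hD, Int.natCast_natAbs, abs_dvd]
  exact (dvd_sub_comm).1 h

theorem normWeight_eq {N : ℕ} (hN : 0 < N) {Δ r C : ℤ} (hC : r ^ 2 - Δ = 4 * N * C)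
    {D : ℕ} (Φ : ZMod D → ℂ) (η κ : ℤ) :
    normWeight N Δ r Φ η (r * η + 2 * N * κ) =
      Φ ((N * κ ^ 2 + r * κ * η + C * η ^ 2 : ℤ) : ZMod D) := by
  have hN0 : (4 * N : ℤ) ≠ 0 := by positivity
  rw [normWeight, if_pos (Int.modEq_iff_dvd.2 ⟨-κ, by ring⟩)]
  congr 2
  refine Int.ediv_eq_of_eq_mul_right hN0 ?_
  linear_combination η ^ 2 * hC

theorem normWeight_eq_normWeight {N : ℕ} (hN : 0 < N) {Δ r C : ℤ} (hC : r ^ 2 - Δ = 4 * N * C)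
    {D : ℕ} (hD : Δ.natAbs = D) (Φ : ZMod D → ℂ) {h k h' k' : ℤ}
    (h1 : k ≡ r * h [ZMOD (2 * (N : ℤ))] ↔ k' ≡ r * h' [ZMOD (2 * (N : ℤ))])
    (h2 : 4 * N * Δ ∣ (k ^ 2 - Δ * h ^ 2) - (k' ^ 2 - Δ * h' ^ 2) ∨
      ∀ κ, k = r * h + 2 * N * κ →
        4 * N * Δ ∣ (k ^ 2 - Δ * h ^ 2) - (k' ^ 2 - Δ * h' ^ 2)) :
    normWeight N Δ r Φ h k = normWeight N Δ r Φ h' k' := by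
  have hN0 : (4 * N : ℤ) ≠ 0 := by positivity
  by_cases hk : k ≡ r * h [ZMOD (2 * (N : ℤ))]
  · obtain ⟨κ, hκ⟩ := hk.symm.dvd
    obtain ⟨κ', hκ'⟩ := (h1.1 hk).symm.dvd
    have e1 : k = r * h + 2 * N * κ := by linear_combination hκ
    have e2 : k' = r * h' + 2 * N * κ' := by linear_combination hκ'
    have h3 : 4 * N * Δ ∣ (k ^ 2 - Δ * h ^ 2) - (k' ^ 2 - Δ * h' ^ 2) := by
      rcases h2 with h2 | h2
      · exact h2
      · exact h2 κ e1
    have h4 : (k ^ 2 - Δ * h ^ 2) - (k' ^ 2 - Δ * h' ^ 2) = 4 * N *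
        ((N * κ ^ 2 + r * κ * h + C * h ^ 2) - (N * κ' ^ 2 + r * κ' * h' + C * h' ^ 2)) := by
      rw [e1, e2]
      linear_combination (h ^ 2 - h' ^ 2) * hC
    rw [h4] at h3
    rw [e1, e2, normWeight_eq hN hC, normWeight_eq hN hC,
      intCast_eq_of_dvd hD (Int.dvd_of_mul_dvd_mul_left hN0 h3)]
  · rw [normWeight, normWeight, if_neg hk, if_neg (fun h' => hk (h1.2 h'))]

theorem normWeight_add_left {N : ℕ} (hN : 0 < N) {Δ r C : ℤ} (hC : r ^ 2 - Δ = 4 * N * C)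
    {D : ℕ} (hD : Δ.natAbs = D) (Φ : ZMod D → ℂ) (h k : ℤ) :
    normWeight N Δ r Φ (h + (2 * N : ℕ)) k = normWeight N Δ r Φ h k := by
  refine normWeight_eq_normWeight hN hC hD Φ ?_ (Or.inl ⟨-(h + N), by push_cast; ring⟩)
  rw [Int.modEq_comm, @Int.modEq_comm _ k]
  exact modEq_congr_left ⟨r, by push_cast; ring⟩

theorem normWeight_add_right {N : ℕ} (hN : 0 < N) {Δ r C : ℤ} (hC : r ^ 2 - Δ = 4 * N * C)
    {D : ℕ} (hD : Δ.natAbs = D) (Φ : ZMod D → ℂ) (h k : ℤ) :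
    normWeight N Δ r Φ h (k + (2 * N * D : ℕ)) = normWeight N Δ r Φ h k := by
  obtain ⟨d, hd⟩ : Δ ∣ (D : ℤ) := hD ▸ Int.dvd_natAbs.2 dvd_rfl
  refine normWeight_eq_normWeight hN hC hD Φ (modEq_congr_left ⟨D, by push_cast; ring⟩)
    (Or.inl ⟨k * d + N * d * D, ?_⟩)
  push_cast
  rw [hd]
  ring

theorem normWeight_shift {N : ℕ} (hN : 0 < N) {Δ r C : ℤ} (hC : r ^ 2 - Δ = 4 * N * C)
    {D : ℕ} (hD : Δ.natAbs = D) (Φ : ZMod D → ℂ) (h k : ℤ) :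
    normWeight N Δ r Φ (h + r) (k + Δ) = normWeight N Δ r Φ h k := by
  symm
  refine normWeight_eq_normWeight hN hC hD Φ ?_ (Or.inr fun κ hκ => ⟨C - κ, ?_⟩)
  · have h1 : ∀ a b : ℤ, a ≡ b [ZMOD (2 * (N : ℤ))] ↔ a - b ≡ 0 [ZMOD (2 * (N : ℤ))] := by
      intro a b
      rw [Int.modEq_zero_iff_dvd, Int.modEq_comm, Int.modEq_iff_dvd]
    rw [h1, h1 (k + Δ)]
    exact modEq_congr_left ⟨2 * C, by linear_combination hC⟩
  · rw [hκ]
    linear_combination Δ * hC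

theorem sum_range_intCast {D : ℕ} [NeZero D] (f : ZMod D → ℂ) :
    ∑ k ∈ Finset.range D, f ((k : ℤ) : ZMod D) = ∑ x : ZMod D, f x := by
  refine Finset.sum_bij' (fun k _ => ((k : ℤ) : ZMod D)) (fun x _ => x.val) ?_ ?_ ?_ ?_ ?_
  · simp
  · intro x _
    exact Finset.mem_range.2 (ZMod.val_lt x)
  · intro k hk
    simpa using Nat.mod_eq_of_lt (Finset.mem_range.1 hk)
  · intro x _
    simp
  · intros; rfl

theorem stdAddChar_intCast {D : ℕ} [NeZero D] (k : ℤ) :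
    ZMod.stdAddChar (k : ZMod D) = e (k / D) := by
  rw [ZMod.stdAddChar_coe, e]
  congr 1
  ring

/-- The finite Fourier transform of a function of the norm, from the corresponding
two-dimensional Fourier transform modulo `Δ`. -/
theorem fourierPer_normWeight {N : ℕ} (hN : 0 < N) {Δ r C : ℤ} {D : ℕ}
    (hΔ : Δ ≠ 0) (hDΔ : Δ.natAbs = D) (hC : r ^ 2 - Δ = 4 * N * C) [NeZero D] (Φ Φ' : ZMod D → ℂ)
    (hloc : ∀ x' y' : ZMod D,
      ∑ x, ∑ y, Φ (N * x ^ 2 + r * x * y + C * y ^ 2) *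
          ZMod.stdAddChar (-(2 * N * x * x' + r * (x * y' + x' * y) + 2 * C * y * y') :
            ZMod D) =
        (∑ x : ZMod D, ∑ y : ZMod D,
          ZMod.stdAddChar (N * x ^ 2 + r * x * y + C * y ^ 2 : ZMod D)) *
          Φ' (N * x' ^ 2 + r * x' * y' + C * y' ^ 2)) (h₀ k' : ℤ) :
    fourierPer (2 * N * D) (normWeight N Δ r Φ h₀) k' =
      e ((1 - (Δ.sign : ℂ)) / 8) * (Real.sqrt D : ℂ) *
        ∑ j ∈ Finset.range (2 * N),
          e (-(Δ.sign : ℂ) * h₀ * j / (2 * N)) * normWeight N Δ r Φ' j k' := by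
  have hD : 0 < D := hDΔ ▸ Int.natAbs_pos.2 hΔ
  have hN0 : (N : ℂ) ≠ 0 := by exact_mod_cast hN.ne'
  have h2N : ((2 * N : ℕ) : ℂ) ≠ 0 := by push_cast; simpa using hN0
  have hD0 : (D : ℂ) ≠ 0 := by exact_mod_cast hD.ne'
  have hs := eq_sign_mul_natAbs hΔ
  rw [hDΔ] at hs
  have hss : (Δ.sign : ℂ) * Δ.sign = 1 := by exact_mod_cast sign_mul_sign hΔ
  have hCc : (r : ℂ) ^ 2 - Δ = 4 * N * C := by exact_mod_cast hC
  have hgauss : (∑ x : ZMod D, ∑ y : ZMod D,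
      (ZMod.stdAddChar (N * x ^ 2 + r * x * y + C * y ^ 2 : ZMod D) : ℂ)) =
      e ((1 - (Δ.sign : ℂ)) / 8) * D * (Real.sqrt D : ℂ) := by
    subst hDΔ
    rw [← binary_gauss_sum hN hΔ hC, Finset.sum_comm]
    simp_rw [← stdAddChar_intCast]
    rw [← sum_range_intCast]
    refine Finset.sum_congr rfl fun η _ => ?_
    rw [← sum_range_intCast]
    refine Finset.sum_congr rfl fun κ _ => ?_
    push_cast
    rfl
  rw [hgauss] at hloc
  set s := Δ.sign with hsdef
  set W := normWeight N Δ r Φ with hW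
  set W' := normWeight N Δ r Φ' with hW'
  set E : ℤ → ℤ → ℤ → ℂ := fun j h k => e ((Δ * h * j - k * k' : ℤ) / (2 * N * D)) with hE
  set S : ℤ → ℂ := fun j => ∑ h ∈ Finset.range (2 * N), ∑ k ∈ Finset.range (2 * N * D),
    W h k * E j h k with hS
  have hEk : ∀ j h k, E j h (k + (2 * N * D : ℕ)) = E j h k := by
    intro j h k
    refine e_eq_of_sub_int (-k') ?_
    push_cast
    field_simp
    ring
  have hEh : ∀ j h k, E j (h + (2 * N : ℕ)) k = E j h k := by
    intro j h k
    refine e_eq_of_sub_int (s * j) ?_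
    push_cast
    rw [hs]
    field_simp
    ring
  have hUk : ∀ j h k, W h (k + (2 * N * D : ℕ)) * E j h (k + (2 * N * D : ℕ)) = W h k * E j h k :=
    fun j h k => by rw [hEk, hW, normWeight_add_right hN hC hDΔ]
  have hUh : ∀ j h k, W (h + (2 * N : ℕ)) k * E j (h + (2 * N : ℕ)) k = W h k * E j h k :=
    fun j h k => by rw [hEh, hW, normWeight_add_left hN hC hDΔ]
  have key : ∀ j : ℤ, S j = (2 * N : ℕ) *
      (e ((1 - (s : ℂ)) / 8) * (Real.sqrt D : ℂ) * W' j k') := by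
    intro j
    by_cases hj : k' ≡ r * j [ZMOD (2 * (N : ℤ))]
    · obtain ⟨κ', hκ'⟩ := hj.symm.dvd
      have e1 : k' = r * j + 2 * N * κ' := by linear_combination hκ'
      have e1c : (k' : ℂ) = r * j + 2 * N * κ' := by exact_mod_cast e1
      have hgr := sum_graded_eq (D := D) hN r (fun h k => W h k * E j h k)
        (fun h k hk => by simp only [hW, normWeight, if_neg hk, zero_mul])
        (hUk j) (hUh j) (by
          intro η κ
          simp only [hW, normWeight_eq hN hC]
          congr 1
          · congr 1
            obtain ⟨d, hd⟩ : Δ ∣ (D : ℤ) := hDΔ ▸ Int.dvd_natAbs.2 dvd_rfl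
            refine intCast_eq_of_dvd hDΔ ⟨d * (r * κ + C * (2 * η + D)), ?_⟩
            rw [hd]; ring
          · refine e_eq_of_sub_int (-2 * C * j - r * κ') ?_
            push_cast
            field_simp
            rw [e1c]
            linear_combination (-(j : ℂ) * D) * hCc)
      have h3 : ∀ η κ : ℤ, W η (r * η + 2 * N * κ) * E j η (r * η + 2 * N * κ) =
          Φ (N * κ ^ 2 + r * κ * η + C * η ^ 2) *
          ZMod.stdAddChar (-(2 * N * κ * κ' + r * (κ * j + κ' * η) + 2 * C * η * j) :
            ZMod D) := by
        intro η κ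
        have h4 : (-(2 * N * κ * κ' + r * (κ * j + κ' * η) + 2 * C * η * j) : ZMod D) =
          ((-(2 * N * κ * κ' + r * (κ * j + κ' * η) + 2 * C * η * j) : ℤ) : ZMod D) := by
          push_cast; rfl
        rw [h4, stdAddChar_intCast, hW, normWeight_eq hN hC]
        congr 1
        · push_cast; rfl
        · rw [hE]
          simp only
          congr 1
          push_cast
          rw [e1c]
          field_simp
          linear_combination (-(j : ℂ) * η) * hCc
      simp_rw [h3] at hgr
      have h5 := hloc κ' j
      rw [Finset.sum_comm, ← sum_range_intCast] at h5
      simp_rw [← sum_range_intCast] at h5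
      rw [h5] at hgr
      have h6 : W' j k' = Φ' (N * κ' ^ 2 + r * κ' * j + C * j ^ 2) := by
        rw [hW', e1, normWeight_eq hN hC]
        push_cast; rfl
      rw [h6]
      apply mul_left_cancel₀ hD0
      rw [hS]
      simp only
      rw [hgr]
      ring
    · have hW0 : W' j k' = 0 := by rw [hW', normWeight, if_neg hj]
      rw [hW0, mul_zero, mul_zero]
      have h1 := sum_range_periodic_shift₂ (F := fun h k => W h k * E j h k) (hUh j) (hUk j) r Δ
      have h2 : ∀ h k, W (h + r) (k + Δ) * E j (h + r) (k + Δ) =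
          e ((s * (r * j - k') : ℤ) / (2 * N : ℕ)) * (W h k * E j h k) := by
        intro h k
        rw [hW, normWeight_shift hN hC hDΔ]
        have : E j (h + r) (k + Δ) = e ((s * (r * j - k') : ℤ) / (2 * N : ℕ)) * E j h k := by
          rw [hE]
          simp only
          rw [← e_add]
          congr 1
          push_cast
          rw [hs]
          field_simp
          ring
        rw [this]; ring
      simp_rw [h2, ← Finset.mul_sum] at h1
      have h3 : e ((s * (r * j - k') : ℤ) / (2 * N : ℕ)) ≠ 1 := by
        intro h4
        rw [e_div_eq_one_iff (by positivity)] at h4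
        apply hj
        have h5 := h4.mul_left s
        rw [← mul_assoc, sign_mul_sign hΔ, one_mul] at h5
        rw [Int.modEq_iff_dvd]
        exact_mod_cast h5
      have h4 : (e ((s * (r * j - k') : ℤ) / (2 * N : ℕ)) - 1) * S j = 0 := by
        rw [sub_mul, one_mul, sub_eq_zero]
        exact h1
      exact (mul_eq_zero.1 h4).resolve_left (sub_ne_zero.2 h3)
  have hinv : ∑ j ∈ Finset.range (2 * N), e (-(s : ℂ) * h₀ * j / (2 * N)) * S j =
      (2 * N : ℕ) * fourierPer (2 * N * D) (W h₀) k' := by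
    set F : ℤ → ℂ := fun h => fourierPer (2 * N * D) (W h) k' with hF
    have hFper : ∀ h, F (h + (2 * N : ℕ)) = F h := by
      intro h
      have : W (h + (2 * N : ℕ)) = W h := by
        funext k
        exact normWeight_add_left hN hC hDΔ _ _ _
      simp only [hF, this]
    have h1 : ∀ j : ℕ, e (-(s : ℂ) * h₀ * j / (2 * N)) * S j =
        ∑ h ∈ Finset.range (2 * N), F h * e (j * ((s * (h - h₀) : ℤ) : ℂ) / (2 * N : ℕ)) := by
      intro j
      rw [hS]
      simp only
      rw [Finset.mul_sum]
      refine Finset.sum_congr rfl fun h _ => ?_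
      rw [hF]
      simp only
      rw [fourierPer, Finset.mul_sum, Finset.sum_mul]
      refine Finset.sum_congr rfl fun k _ => ?_
      rw [mul_left_comm, mul_assoc (W _ _)]
      congr 1
      rw [hE]
      simp only
      rw [← e_add, ← e_add]
      congr 1
      push_cast
      rw [hs]
      field_simp
      ring
    simp_rw [h1]
    rw [Finset.sum_comm]
    simp_rw [← Finset.mul_sum, sum_e_div (n := 2 * N) (by positivity)]
    set F' : ℤ → ℂ := fun h => F h * (if ((2 * N : ℕ) : ℤ) ∣ s * (h - h₀) then
      ((2 * N : ℕ) : ℂ) else 0) with hF'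
    have hF'per : ∀ h, F' (h + (2 * N : ℕ)) = F' h := by
      intro h
      simp only [hF', hFper]
      congr 1
      refine if_congr ?_ rfl rfl
      have : s * (h + (2 * N : ℕ) - h₀) = s * (h - h₀) + (2 * N : ℕ) * s := by ring
      rw [this]
      exact dvd_add_left (dvd_mul_right _ _)
    change ∑ h ∈ Finset.range (2 * N), F' h = _
    rw [← sum_range_periodic_shift hF'per h₀, Finset.sum_eq_single 0]
    · simp only [hF', Nat.cast_zero, zero_add, sub_self, mul_zero, dvd_zero, if_true]
      exact mul_comm _ _
    · intro i hi hi0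
      rw [hF']
      simp only
      rw [if_neg, mul_zero]
      intro h2
      have h3 := h2.mul_left s
      rw [← mul_assoc, sign_mul_sign hΔ, one_mul, add_sub_cancel_right] at h3
      exact hi0 (Nat.eq_zero_of_dvd_of_lt (by exact_mod_cast h3) (Finset.mem_range.1 hi))
    · intro h2
      exact absurd (Finset.mem_range.2 (by positivity)) h2
  simp_rw [key] at hinv
  apply mul_left_cancel₀ h2N
  rw [← hinv, Finset.mul_sum, Finset.mul_sum]
  refine Finset.sum_congr rfl fun j _ => ?_
  ring

/-- The kernel `[t α = A x² + B x y + C y²] w(t, α)`, viewed as a function of a vector in a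
quaternary quadratic space, is an eigenfunction of the Fourier transform. -/
def FourierSelfDual {R : Type*} [CommRing R] [Fintype R] (A B C : R) (w : R → R → ℂ) : Prop :=
  ∀ Ψ : AddChar R ℂ, Ψ.IsPrimitive → ∀ α β x' y' : R,
    ∑ x, ∑ y, ∑ t, (if t * α = A * x ^ 2 + B * x * y + C * y ^ 2 then w t α else 0) *
        Ψ (β * t - (2 * A * x * x' + B * (x * y' + x' * y) + 2 * C * y * y')) =
      (∑ x, ∑ y, Ψ (A * x ^ 2 + B * x * y + C * y ^ 2)) *
        ∑ t, (if t * β = A * x' ^ 2 + B * x' * y' + C * y' ^ 2 then w t β else 0) * Ψ (-(α * t))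

theorem FourierSelfDual.swap {R : Type*} [CommRing R] [Fintype R] {A B C : R} {w : R → R → ℂ}
    (h : FourierSelfDual A B C w) : FourierSelfDual C B A w := by
  intro Ψ hΨ α β x' y'
  have h1 := h Ψ hΨ α β y' x'
  rw [Finset.sum_comm, @Finset.sum_comm _ _ _ _ _ _ (fun x y => Ψ _)] at h1
  have e1 : ∀ x y : R, C * x ^ 2 + B * x * y + A * y ^ 2 = A * y ^ 2 + B * y * x + C * x ^ 2 :=
    fun x y => by ring
  have e2 : ∀ x y : R, 2 * C * x * x' + B * (x * y' + x' * y) + 2 * A * y * y' =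
      2 * A * y * y' + B * (y * x' + y' * x) + 2 * C * x * x' := fun x y => by ring
  simp only [e1, e2]
  exact h1

theorem FourierSelfDual.of_ringEquiv {R S : Type*} [CommRing R] [Fintype R] [CommRing S]
    [Fintype S] (f : R ≃+* S) {A B C : R} {w : S → S → ℂ}
    (h : FourierSelfDual (f A) (f B) (f C) w) :
    FourierSelfDual A B C (fun t β => w (f t) (f β)) := by
  intro Ψ hΨ α β x' y'
  have h1 := h (Ψ.compAddMonoidHom f.symm.toAddMonoidHom) (by
    intro a ha h2
    refine hΨ (a := f.symm a) (by simpa using ha) ?_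
    ext x
    have := DFunLike.congr_fun h2 (f x)
    simpa [AddChar.mulShift_apply] using this) (f α) (f β) (f x') (f y')
  simp only [← f.toEquiv.sum_comp, RingEquiv.toEquiv_eq_coe, EquivLike.coe_coe,
    AddChar.compAddMonoidHom_apply] at h1
  have h2 : (2 : S) = f 2 := (map_ofNat f 2).symm
  simp only [h2, ← map_mul, ← map_add, ← map_pow, ← map_sub, ← map_neg, f.injective.eq_iff] at h1
  simpa using h1

theorem AddChar.eq_prod_single {ι : Type*} [Fintype ι] [DecidableEq ι] {R : ι → Type*}
    [∀ i, CommRing (R i)] (Ψ : AddChar (∀ i, R i) ℂ) (x : ∀ i, R i) :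
    Ψ x = ∏ i, Ψ.compAddMonoidHom (AddMonoidHom.single R i) (x i) := by
  conv_lhs => rw [← Finset.univ_sum_single x]
  generalize (Finset.univ : Finset ι) = s
  induction s using Finset.induction_on with
  | empty => simp
  | insert i s hi ih =>
    rw [Finset.sum_insert hi, Finset.prod_insert hi, AddChar.map_add_eq_mul, ih]
    rfl

theorem AddChar.IsPrimitive.comp_single {ι : Type*} [Fintype ι] [DecidableEq ι] {R : ι → Type*}
    [∀ i, CommRing (R i)] {Ψ : AddChar (∀ i, R i) ℂ} (hΨ : Ψ.IsPrimitive) (i : ι) :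
    (Ψ.compAddMonoidHom (AddMonoidHom.single R i)).IsPrimitive := by
  intro a ha h
  refine hΨ (a := Pi.single i a) (by simpa using ha) ?_
  ext x
  have h1 := DFunLike.congr_fun h (x i)
  simp only [AddChar.mulShift_apply, AddChar.compAddMonoidHom_apply, AddMonoidHom.single_apply,
    AddChar.one_apply] at h1 ⊢
  rwa [← Pi.single_mul_left]

theorem FourierSelfDual.pi {ι : Type*} [Fintype ι] [DecidableEq ι] {R : ι → Type*}
    [∀ i, CommRing (R i)] [∀ i, Fintype (R i)] {A B C : ∀ i, R i} {w : ∀ i, R i → R i → ℂ}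
    (h : ∀ i, FourierSelfDual (A i) (B i) (C i) (w i)) :
    FourierSelfDual A B C (fun t β => ∏ i, w i (t i) (β i)) := by
  intro Ψ hΨ α β x' y'
  have h1 := Finset.prod_congr rfl fun i (_ : i ∈ Finset.univ) =>
    h i _ (hΨ.comp_single i) (α i) (β i) (x' i) (y' i)
  rw [Finset.prod_mul_distrib] at h1
  simp only [Fintype.prod_sum, Finset.prod_mul_distrib] at h1
  simp only [AddChar.eq_prod_single Ψ, Pi.add_apply, Pi.mul_apply, Pi.sub_apply, Pi.pow_apply,
    Pi.neg_apply, funext_iff, Pi.ofNat_apply]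
  simp only [Fintype.prod_ite_zero] at h1
  exact h1

section

variable {F : Type*} [Field F] [Fintype F]

/-- The complex-valued quadratic character. -/
def quadCharC (F : Type*) [Field F] [Fintype F] : MulChar F ℂ :=
  (quadraticChar F).ringHomComp (Int.castRingHom ℂ)

theorem quadCharC_apply (a : F) : quadCharC F a = (quadraticChar F a : ℂ) := rfl

theorem quadCharC_mul_self {a : F} (ha : a ≠ 0) : quadCharC F a * quadCharC F a = 1 := by
  rw [quadCharC_apply, ← Int.cast_mul, ← sq, quadraticChar_sq_one ha, Int.cast_one]

theorem quadCharC_inv {a : F} (ha : a ≠ 0) : quadCharC F a⁻¹ = quadCharC F a := by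
  have h1 := quadCharC_mul_self ha
  have h2 : quadCharC F a * quadCharC F a⁻¹ = 1 := by
    rw [← map_mul, mul_inv_cancel₀ ha, map_one]
  have h3 : quadCharC F a ≠ 0 := left_ne_zero_of_mul_eq_one h2
  exact mul_left_cancel₀ h3 (h2.trans h1.symm)

theorem quadCharC_ne_one (hF : ringChar F ≠ 2) : quadCharC F ≠ 1 := by
  intro h
  obtain ⟨a, ha⟩ := quadraticChar_exists_neg_one hF
  have ha0 : a ≠ 0 := by rintro rfl; simp at ha
  have h1 : quadCharC F a = 1 := by rw [h, MulChar.one_apply ha0.isUnit]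
  rw [quadCharC_apply, ha] at h1
  norm_num at h1

theorem sum_quadCharC_mul (Ψ : AddChar F ℂ) {c : F} (hc : c ≠ 0) :
    ∑ t, quadCharC F t * Ψ (c * t) = quadCharC F c * gaussSum (quadCharC F) Ψ := by
  have h := gaussSum_mulShift (quadCharC F) Ψ (Units.mk0 c hc)
  rw [Units.val_mk0] at h
  rw [← h, ← mul_assoc, quadCharC_mul_self hc, one_mul, gaussSum]
  rfl

theorem sum_addChar_mul {Ψ : AddChar F ℂ} (hΨ : Ψ.IsPrimitive) (b : F) :
    ∑ z, Ψ (b * z) = if b = 0 then (Fintype.card F : ℂ) else 0 := by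
  have h := AddChar.sum_mulShift b hΨ
  rw [Nat.cast_ite, Nat.cast_zero] at h
  rw [← h]
  exact Finset.sum_congr rfl fun z _ => by rw [mul_comm]

theorem sum_addChar_mul_sq (hF : ringChar F ≠ 2) {Ψ : AddChar F ℂ} (hΨ : Ψ.IsPrimitive) {c : F}
    (hc : c ≠ 0) : ∑ z, Ψ (c * z ^ 2) = quadCharC F c * gaussSum (quadCharC F) Ψ := by
  have h1 : ∑ z, Ψ (c * z ^ 2) = ∑ t, ((quadCharC F t) * Ψ (c * t) + Ψ (c * t)) := by
    rw [← Finset.sum_fiberwise (s := Finset.univ) (g := fun z : F => z ^ 2)]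
    refine Finset.sum_congr rfl fun t _ => ?_
    rw [Finset.sum_congr rfl (g := fun _ => Ψ (c * t))
      (fun z hz => by rw [(Finset.mem_filter.1 hz).2])]
    rw [Finset.sum_const, nsmul_eq_mul, ← add_one_mul]
    congr 1
    have h2 := quadraticChar_card_sqrts hF t
    rw [quadCharC_apply, ← Int.cast_one (R := ℂ), ← Int.cast_add, ← h2, Int.cast_natCast]
    congr 2
    ext z
    simp
  rw [h1, Finset.sum_add_distrib, sum_quadCharC_mul Ψ hc, sum_addChar_mul hΨ, if_neg hc, add_zero]

theorem quadCharC_gauss_sq (hF : ringChar F ≠ 2) {Ψ : AddChar F ℂ} (hΨ : Ψ.IsPrimitive) :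
    gaussSum (quadCharC F) Ψ ^ 2 = quadCharC F (-1) * Fintype.card F := by
  refine gaussSum_sq (quadCharC_ne_one hF) ?_ hΨ
  exact (quadraticChar_isQuadratic F).comp _

/-- The local weight attached to a value `A` of a degenerate binary quadratic form. -/
def fieldWeight (A t β : F) : ℂ := if β = 0 then quadCharC F (A * t) else quadCharC F β

theorem fourierSelfDual_line (hF : ringChar F ≠ 2) {A : F} (hA : A ≠ 0) {Ψ : AddChar F ℂ}
    (hΨ : Ψ.IsPrimitive) (α β z' : F) :
    ∑ z, ∑ t, (if t * α = A * z ^ 2 then fieldWeight A t α else 0) * Ψ (β * t - 2 * A * z * z') =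
      (∑ z, Ψ (A * z ^ 2)) *
        ∑ t, (if t * β = A * z' ^ 2 then fieldWeight A t β else 0) * Ψ (-(α * t)) := by
  have h2 : (2 : F) ≠ 0 := Ring.two_ne_zero hF
  have hg := quadCharC_gauss_sq hF hΨ
  have hunit : ∀ (β u : F) (f : F → ℂ), β ≠ 0 →
      ∑ t, (if t * β = u then fieldWeight A t β else 0) * f t = quadCharC F β * f (u * β⁻¹) := by
    intro β u f hβ
    rw [Finset.sum_eq_single (u * β⁻¹)]
    · rw [if_pos (by field_simp), fieldWeight, if_neg hβ]
    · intro t _ ht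
      rw [if_neg, zero_mul]
      rintro rfl
      exact ht (by field_simp)
    · simp
  have hzero : ∀ (z : F) (f : F → ℂ),
      ∑ t, (if t * 0 = A * z ^ 2 then fieldWeight A t 0 else 0) * f t =
        if z = 0 then ∑ t, quadCharC F (A * t) * f t else 0 := by
    intro z f
    split_ifs with hz
    · subst hz
      simp [fieldWeight]
    · refine Finset.sum_eq_zero fun t _ => ?_
      rw [if_neg, zero_mul]
      rw [mul_zero]
      exact (mul_ne_zero hA (pow_ne_zero 2 hz)).symm
  rw [sum_addChar_mul_sq hF hΨ hA]
  by_cases hα : α = 0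
  · subst hα
    simp_rw [hzero]
    rw [Finset.sum_ite_eq' Finset.univ (0 : F), if_pos (Finset.mem_univ _)]
    by_cases hβ : β = 0
    · subst hβ
      rw [hzero]
      simp only [zero_mul, mul_zero, sub_zero, neg_zero, AddChar.map_zero_eq_one, mul_one,
        map_mul, ← Finset.mul_sum, MulChar.sum_eq_zero_of_ne_one (quadCharC_ne_one hF), ite_self]
    · rw [hunit β _ _ hβ]
      simp only [mul_zero, zero_mul, sub_zero, neg_zero, AddChar.map_zero_eq_one, mul_one, map_mul,
        mul_assoc, ← Finset.mul_sum, sum_quadCharC_mul Ψ hβ]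
      ring
  · simp_rw [hunit α _ _ hα]
    rw [← Finset.mul_sum]
    by_cases hβ : β = 0
    · subst hβ
      rw [hzero]
      have h3 : ∀ z, Ψ (0 * (A * z ^ 2 * α⁻¹) - 2 * A * z * z') = Ψ ((-(2 * A * z')) * z) :=
        fun z => by congr 1; ring
      simp_rw [h3]
      rw [sum_addChar_mul hΨ]
      by_cases hz : z' = 0
      · rw [if_pos (by rw [hz]; ring), if_pos hz]
        have h4 : ∀ t, quadCharC F (A * t) * Ψ (-(α * t)) =
            quadCharC F A * (quadCharC F t * Ψ (-α * t)) := fun t => by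
          rw [map_mul, neg_mul]; ring
        simp_rw [h4]
        rw [← Finset.mul_sum, sum_quadCharC_mul Ψ (neg_ne_zero.2 hα), ← neg_one_mul α, map_mul]
        have h5 := quadCharC_mul_self hA
        have h6 : quadCharC F (-1) * quadCharC F (-1) = 1 :=
          quadCharC_mul_self (neg_ne_zero.2 one_ne_zero)
        linear_combination (-quadCharC F α * quadCharC F A ^ 2 * quadCharC F (-1)) * hg -
          (quadCharC F α * Fintype.card F * quadCharC F (-1) ^ 2) * h5 -
            (quadCharC F α * Fintype.card F) * h6
      · rw [if_neg (neg_ne_zero.2 (mul_ne_zero (mul_ne_zero h2 hA) hz)), if_neg hz]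
        simp
    · rw [hunit β _ _ hβ]
      have h3 : ∑ z, Ψ (β * (A * z ^ 2 * α⁻¹) - 2 * A * z * z') =
          ∑ z, Ψ (β * A * α⁻¹ * z ^ 2) * Ψ (-(α * (A * z' ^ 2 * β⁻¹))) := by
        rw [← Equiv.sum_comp (Equiv.addRight (α * β⁻¹ * z'))]
        refine Finset.sum_congr rfl fun z _ => ?_
        rw [← AddChar.map_add_eq_mul, Equiv.coe_addRight]
        congr 1
        field_simp
        ring
      rw [h3, ← Finset.sum_mul, sum_addChar_mul_sq hF hΨ
        (mul_ne_zero (mul_ne_zero hβ hA) (inv_ne_zero hα)), map_mul, map_mul, quadCharC_inv hα]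
      linear_combination (quadCharC F β * quadCharC F A * gaussSum (quadCharC F) Ψ *
        Ψ (-(α * (A * z' ^ 2 * β⁻¹)))) * quadCharC_mul_self hα

theorem fourierSelfDual_field (hF : ringChar F ≠ 2) {A B C : F} (hA : A ≠ 0)
    (hdisc : B ^ 2 = 4 * A * C) : FourierSelfDual A B C (fieldWeight A) := by
  intro Ψ hΨ α β x' y'
  have h2 : (2 : F) ≠ 0 := Ring.two_ne_zero hF
  obtain ⟨b, rfl⟩ : ∃ b, B = 2 * A * b := ⟨B / (2 * A), by field_simp⟩
  obtain rfl : C = A * b ^ 2 := by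
    have h4 : (4 : F) * A ≠ 0 := by
      have : (4 : F) = 2 * 2 := by norm_num
      rw [this]
      exact mul_ne_zero (mul_ne_zero h2 h2) hA
    apply mul_left_cancel₀ h4
    rw [← hdisc]; ring
  have e1 : ∀ x y, A * x ^ 2 + 2 * A * b * x * y + A * b ^ 2 * y ^ 2 = A * (x + b * y) ^ 2 :=
    fun x y => by ring
  have e2 : ∀ x y, 2 * A * x * x' + 2 * A * b * (x * y' + x' * y) + 2 * (A * b ^ 2) * y * y' =
      2 * A * (x + b * y) * (x' + b * y') := fun x y => by ring
  simp only [e1, e2]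
  rw [Finset.sum_comm, Finset.sum_comm (f := fun x y => Ψ (A * (x + b * y) ^ 2))]
  have h3 : ∀ (f : F → ℂ), ∑ y, ∑ x, f (x + b * y) = Fintype.card F * ∑ x, f x := by
    intro f
    have : ∀ y, ∑ x, f (x + b * y) = ∑ x, f x := fun y => Equiv.sum_comp (Equiv.addRight (b * y)) f
    simp_rw [this]
    simp
  rw [h3 (fun z => Ψ (A * z ^ 2)), h3 (fun z => ∑ t, (if t * α = A * z ^ 2 then
    fieldWeight A t α else 0) * Ψ (β * t - 2 * A * z * (x' + b * y'))),
    fourierSelfDual_line hF hA hΨ, mul_assoc]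

end

theorem MulChar.IsQuadratic.mul_self {R : Type*} [CommRing R] {χ : MulChar R ℤ} (hχ : χ.IsQuadratic) {u : R}
    (hu : IsUnit u) : (χ u : ℂ) * (χ u : ℂ) = 1 := by
  have h1 := hu.map χ
  rcases hχ u with h | h | h
  · rw [h] at h1; simp at h1
  · rw [h]; simp
  · rw [h]; simp

theorem AddChar.IsPrimitive.mulShift_unit {R : Type*} [CommRing R] {Ψ : AddChar R ℂ} (hΨ : Ψ.IsPrimitive) (u : Rˣ) :
    (Ψ.mulShift u).IsPrimitive := by
  intro a ha h
  refine hΨ (a := u * a) (by simpa using ha) ?_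
  rw [← h, AddChar.mulShift_mulShift]

section

variable {R : Type*} [CommRing R] [Fintype R]

/-- The local weight attached to a character `χ` of a local ring and a unit `A`. -/
def unitWeight (χ : MulChar R ℤ) (A t β : R) : ℂ :=
  if IsUnit β then (χ β : ℂ) else (χ (A * t) : ℂ)

/-- Reduction of `A x² + 2 A b x y + A (b² - m) y²` to the form `x² - m y²`. -/
theorem FourierSelfDual.of_diagonal {χ : MulChar R ℤ} (hχ : χ.IsQuadratic) {m : R}
    (h : FourierSelfDual 1 0 (-m) (unitWeight χ 1)) (A : Rˣ) (b : R) :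
    FourierSelfDual (A : R) (2 * A * b) (A * (b ^ 2 - m)) (unitWeight χ A) := by
  intro Ψ hΨ α β x' y'
  have hA : (χ A : ℂ) * χ A = 1 := hχ.mul_self A.isUnit
  have h1 := h _ (hΨ.mulShift_unit A) α β (x' + b * y') y'
  have hq : ∀ x y : R, A * x ^ 2 + 2 * A * b * x * y + A * (b ^ 2 - m) * y ^ 2 =
      A * (1 * (x + b * y) ^ 2 + 0 * (x + b * y) * y + -m * y ^ 2) := fun x y => by ring
  have hB : ∀ x y : R, 2 * A * x * x' + 2 * A * b * (x * y' + x' * y) +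
      2 * (A * (b ^ 2 - m)) * y * y' = A * (2 * 1 * (x + b * y) * (x' + b * y') +
        0 * ((x + b * y) * y' + (x' + b * y') * y) + 2 * -m * y * y') := fun x y => by ring
  have hshift : ∀ f : R → R → ℂ, ∑ x, ∑ y, f (x + b * y) y = ∑ x, ∑ y, f x y := by
    intro f
    rw [Finset.sum_comm, Finset.sum_comm (f := f)]
    exact Finset.sum_congr rfl fun y _ => Equiv.sum_comp (Equiv.addRight (b * y)) (f · y)
  have ht : ∀ (γ u : R) (f : R → ℂ),
      ∑ t, (if t * γ = A * u then unitWeight χ A t γ else 0) * f t =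
        ∑ t, (if t * γ = u then unitWeight χ 1 t γ else 0) * f (A * t) := by
    intro γ u f
    rw [← Equiv.sum_comp A.mulLeft]
    refine Finset.sum_congr rfl fun t _ => ?_
    congr 1
    simp only [Units.mulLeft_apply]
    refine if_ctx_congr ?_ (fun _ => ?_) fun _ => rfl
    · rw [mul_assoc, Units.mul_right_inj]
    · rw [unitWeight, unitWeight, one_mul, ← mul_assoc, map_mul, map_mul]
      push_cast
      rw [hA, one_mul]
  simp only [hq, hB, ht]
  rw [hshift (fun x y => Ψ (A * (1 * x ^ 2 + 0 * x * y + -m * y ^ 2))),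
    hshift (fun x y => ∑ t, (if t * α = 1 * x ^ 2 + 0 * x * y + -m * y ^ 2 then
      unitWeight χ 1 t α else 0) * Ψ (β * (A * t) - A * (2 * 1 * x * (x' + b * y') +
        0 * (x * y' + (x' + b * y') * y) + 2 * -m * y * y')))]
  simp only [AddChar.mulShift_apply, mul_sub, mul_neg] at h1
  have e1 : ∀ γ t : R, γ * (A * t) = A * (γ * t) := fun γ t => by ring
  simp only [e1, mul_neg]
  exact h1

/-- Reduction of the Fourier self-duality for `x² - m y²` to the cases where one of the two
parameters equals one. -/
theorem fourierSelfDual_diagonal {χ : MulChar R ℤ} (hχ : χ.IsQuadratic) {m s : R}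
    (hs : ∀ a : R, ¬ IsUnit a → a * s = 0) (hχs : ∀ t, χ (t + s) = - χ t)
    (h₁ : ∀ Ψ : AddChar R ℂ, Ψ.IsPrimitive → ∀ β : R, IsUnit β →
      ∑ x, ∑ y, Ψ (β * (x ^ 2 - m * y ^ 2)) = χ β * ∑ x, ∑ y, Ψ (x ^ 2 - m * y ^ 2))
    (h₂ : ∀ Ψ : AddChar R ℂ, Ψ.IsPrimitive → ∀ β : R, ¬ IsUnit β → ∀ x' y' : R,
      ∑ x, ∑ y, Ψ (β * (x ^ 2 - m * y ^ 2) - (2 * x * x' - 2 * m * y * y')) =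
        (∑ x, ∑ y, Ψ (x ^ 2 - m * y ^ 2)) *
          ∑ t, (if t * β = x' ^ 2 - m * y' ^ 2 then (χ t : ℂ) else 0) * Ψ (-t))
    (h₃ : ∀ Ψ : AddChar R ℂ, Ψ.IsPrimitive → ∀ α : R, ¬ IsUnit α → ∀ x' y' : R,
      ∑ x, ∑ y, ∑ t, (if t * α = x ^ 2 - m * y ^ 2 then (χ t : ℂ) else 0) *
        Ψ (t - (2 * x * x' - 2 * m * y * y')) =
        (∑ x, ∑ y, Ψ (x ^ 2 - m * y ^ 2)) * Ψ (-(α * (x' ^ 2 - m * y' ^ 2)))) :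
    FourierSelfDual 1 0 (-m) (unitWeight χ 1) := by
  intro Ψ hΨ α β x' y'
  have hq : ∀ x y : R, 1 * x ^ 2 + 0 * x * y + -m * y ^ 2 = x ^ 2 - m * y ^ 2 :=
    fun x y => by ring
  have hB : ∀ x y : R, 2 * 1 * x * x' + 0 * (x * y' + x' * y) + 2 * -m * y * y' =
      2 * x * x' - 2 * m * y * y' := fun x y => by ring
  simp only [hq, hB]
  have hscale : ∀ (γ z : R) (u : Rˣ) (f : R → ℂ),
      ∑ t, (if t * γ = z then unitWeight χ 1 t γ else 0) * f t =
        χ u * ∑ t, (if t * (u * γ) = z then unitWeight χ 1 t (u * γ) else 0) * f (u * t) := by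
    intro γ z u f
    have hu := hχ.mul_self u.isUnit
    rw [← Equiv.sum_comp u.mulLeft, Finset.mul_sum]
    refine Finset.sum_congr rfl fun t _ => ?_
    rw [← mul_assoc]
    congr 1
    simp only [Units.mulLeft_apply, mul_ite, mul_zero]
    refine if_ctx_congr (by rw [mul_comm (u : R) t, mul_assoc]) (fun _ => ?_) fun _ => rfl
    simp only [unitWeight, one_mul, Units.isUnit_units_mul, map_mul, Int.cast_mul]
    split_ifs
    · linear_combination (-(χ γ : ℂ)) * hu
    · rfl
  have hone : ∀ (z : R) (f : R → ℂ),
      ∑ t, (if t * 1 = z then unitWeight χ 1 t 1 else 0) * f t = f z := by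
    intro z f
    simp [unitWeight]
  have hnon : ∀ (γ z : R) (f : R → ℂ), ¬ IsUnit γ →
      ∑ t, (if t * γ = z then unitWeight χ 1 t γ else 0) * f t =
        ∑ t, (if t * γ = z then (χ t : ℂ) else 0) * f t := by
    intro γ z f hγ
    simp [unitWeight, hγ]
  by_cases hα : IsUnit α
  · obtain ⟨a, rfl⟩ := hα
    have h4 : ∀ t : R, (a : R) * (((a⁻¹ : Rˣ) : R) * t) = t := fun t => by simp
    have h5 := (hχ.mul_self a⁻¹.isUnit)
    have h6 := fun z f => hscale a z a⁻¹ f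
    simp only [Units.inv_mul, hone] at h6
    simp only [h6, hscale β _ a⁻¹, h4, ← Finset.mul_sum, mul_left_comm _ (χ _ : ℂ)]
    congr 1
    have h7 : ∀ z : R, β * (((a⁻¹ : Rˣ) : R) * z) = (((a⁻¹ : Rˣ) : R) * β) * z := fun z => by ring
    simp only [h7]
    generalize ((a⁻¹ : Rˣ) : R) * β = b
    by_cases hb : IsUnit b
    · have hb' := hb
      obtain ⟨b, rfl⟩ := hb
      have hsq : ∀ x y : R, (b : R) * ((x + ((b⁻¹ : Rˣ) : R) * x') ^ 2 -
          m * (y + ((b⁻¹ : Rˣ) : R) * y') ^ 2) - (2 * (x + ((b⁻¹ : Rˣ) : R) * x') * x' -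
          2 * m * (y + ((b⁻¹ : Rˣ) : R) * y') * y') =
          b * (x ^ 2 - m * y ^ 2) + -(((b⁻¹ : Rˣ) : R) * (x' ^ 2 - m * y' ^ 2)) := by
        intro x y
        have h8 : (b : R) * ((b⁻¹ : Rˣ) : R) = 1 := by simp
        linear_combination (2 * x * x' + ((b⁻¹ : Rˣ) : R) * x' ^ 2 - 2 * m * y * y' -
          m * ((b⁻¹ : Rˣ) : R) * y' ^ 2) * h8
      have h9 : ∑ x, ∑ y, Ψ (b * (x ^ 2 - m * y ^ 2) - (2 * x * x' - 2 * m * y * y')) =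
          ∑ x, ∑ y, Ψ (b * (x ^ 2 - m * y ^ 2) + -(((b⁻¹ : Rˣ) : R) * (x' ^ 2 - m * y' ^ 2))) := by
        rw [← Equiv.sum_comp (Equiv.addRight (((b⁻¹ : Rˣ) : R) * x'))]
        refine Finset.sum_congr rfl fun x _ => ?_
        rw [← Equiv.sum_comp (Equiv.addRight (((b⁻¹ : Rˣ) : R) * y'))]
        refine Finset.sum_congr rfl fun y _ => ?_
        rw [Equiv.coe_addRight, Equiv.coe_addRight, hsq]
      rw [h9]
      simp only [AddChar.map_add_eq_mul, ← Finset.sum_mul]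
      have h10 : ∀ t : R, t * b = x' ^ 2 - m * y' ^ 2 ↔
          t = ((b⁻¹ : Rˣ) : R) * (x' ^ 2 - m * y' ^ 2) := by
        intro t
        rw [← Units.eq_mul_inv_iff_mul_eq, mul_comm]
      simp only [h10, ite_mul, zero_mul, Finset.sum_ite_eq', Finset.mem_univ, if_true]
      rw [h₁ Ψ hΨ b hb', unitWeight, if_pos hb']
      ring
    · rw [h₂ Ψ hΨ b hb, hnon _ _ _ hb]
  · by_cases hβ : IsUnit β
    · obtain ⟨b, rfl⟩ := hβ
      have h6 := fun z f => hscale b z b⁻¹ f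
      simp only [Units.inv_mul, hone] at h6
      have h4 : ∀ t : R, (b : R) * (((b⁻¹ : Rˣ) : R) * t) = t := fun t => by simp
      have h7 : ∀ z : R, α * (((b⁻¹ : Rˣ) : R) * z) = (((b⁻¹ : Rˣ) : R) * α) * z :=
        fun z => by ring
      have hα' : ¬ IsUnit (((b⁻¹ : Rˣ) : R) * α) := by rwa [Units.isUnit_units_mul]
      simp only [h6, hscale α _ b⁻¹, h4, ← Finset.mul_sum, mul_left_comm _ (χ _ : ℂ), h7]
      congr 1
      simp only [hnon _ _ _ hα']
      exact h₃ Ψ hΨ _ hα' x' y'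
    · have hvan : ∀ (γ δ z c : R), ¬ IsUnit γ → ¬ IsUnit δ →
          ∑ t, (if t * γ = z then unitWeight χ 1 t γ else 0) * Ψ (δ * t + c) = 0 := by
        intro γ δ z c hγ hδ
        rw [hnon _ _ _ hγ]
        have h8 : ∑ t, (if t * γ = z then (χ t : ℂ) else 0) * Ψ (δ * t + c) =
            ∑ t, -((if t * γ = z then (χ t : ℂ) else 0) * Ψ (δ * t + c)) := by
          conv_lhs => rw [← Equiv.sum_comp (Equiv.addRight s)]
          refine Finset.sum_congr rfl fun t _ => ?_
          simp only [Equiv.coe_addRight, hχs, add_mul, mul_add, hs δ hδ, mul_comm s γ, hs γ hγ,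
            add_zero]
          split_ifs <;> push_cast <;> ring
        rw [Finset.sum_neg_distrib] at h8
        exact self_eq_neg.1 h8
      have h9 := fun z c => hvan α β z c hα hβ
      have h10 := hvan β (-α) (x' ^ 2 - m * y' ^ 2) 0 hβ (by rwa [IsUnit.neg_iff])
      simp only [add_zero, neg_mul] at h10
      rw [h10, mul_zero]
      simp only [sub_eq_add_neg] at h9 ⊢
      simp only [h9, Finset.sum_const_zero]

end

/-- Two combinations of the values of a character agree if they agree modulo the relation
`Ψ (z + s) = - Ψ z`. -/
theorem sum_eq_of_antiperiodic {R : Type*} [CommRing R] [Fintype R] {Ψ : R → ℂ} {s : R}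
    (hs : s + s = 0) (hΨ : ∀ z, Ψ (z + s) = -Ψ z) {T : R → Prop} (hT : ∀ z, T z ∨ T (z + s))
    {a b : R → ℤ} (h : ∀ z, T z → a z - a (z + s) = b z - b (z + s)) :
    ∑ z, (a z : ℂ) * Ψ z = ∑ z, (b z : ℂ) * Ψ z := by
  have key : ∀ a : R → ℤ, 2 * ∑ z, (a z : ℂ) * Ψ z = ∑ z, ((a z - a (z + s) : ℤ) : ℂ) * Ψ z := by
    intro a
    have h1 : ∑ z, (a z : ℂ) * Ψ z = ∑ z, (a (z + s) : ℂ) * Ψ (z + s) :=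
      (Equiv.sum_comp (Equiv.addRight s) (fun z => (a z : ℂ) * Ψ z)).symm
    rw [two_mul]
    nth_rewrite 2 [h1]
    rw [← Finset.sum_add_distrib]
    refine Finset.sum_congr rfl fun z _ => ?_
    rw [hΨ]
    push_cast
    ring
  have h' : ∀ z, a z - a (z + s) = b z - b (z + s) := by
    intro z
    rcases hT z with hz | hz
    · exact h z hz
    · have h2 := h _ hz
      rw [add_assoc, hs, add_zero] at h2
      linarith
  refine mul_left_cancel₀ (two_ne_zero (α := ℂ)) ?_
  rw [key, key]
  simp only [h']

theorem AddChar.IsPrimitive.antiperiodic {R : Type*} [CommRing R] {Ψ : AddChar R ℂ}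
    (hΨ : Ψ.IsPrimitive) {s : R} (hs : s ≠ 0) (h2 : ∀ a : R, a * s = 0 ∨ a * s = s) (z : R) :
    Ψ (z + s) = -Ψ z := by
  have h1 : Ψ s ≠ 1 := by
    intro h
    refine hΨ hs ?_
    ext a
    rw [AddChar.mulShift_apply, AddChar.one_apply, mul_comm]
    rcases h2 a with h' | h' <;> rw [h']
    · simp
    · exact h
  have h3 : Ψ s * Ψ s = 1 := by
    rw [← AddChar.map_add_eq_mul]
    rcases h2 2 with h' | h'
    · rw [← two_mul, h', AddChar.map_zero_eq_one]
    · exact absurd (by linear_combination h') hs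
  have h4 : (Ψ s - 1) * (Ψ s + 1) = 0 := by linear_combination h3
  rcases mul_eq_zero.1 h4 with h | h
  · exact absurd (sub_eq_zero.1 h) h1
  · rw [AddChar.map_add_eq_mul, eq_neg_of_add_eq_zero_left h]
    ring

theorem sum_comp_eq_sum_card {ι R : Type*} [Fintype ι] [Fintype R] [DecidableEq R] (Ψ : R → ℂ)
    (g : ι → R) :
    ∑ i, Ψ (g i) = ∑ z, ((∑ i, if g i = z then 1 else 0 : ℤ) : ℂ) * Ψ z := by
  simp only [Int.cast_sum, Finset.sum_mul]
  rw [Finset.sum_comm]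
  simp

theorem ZMod.isUnit_or_mul_two {β : ZMod 4} : IsUnit β ∨ 2 * β = 0 := by
  have h : ∀ β : ZMod 4, (∃ c, β * c = 1) ∨ 2 * β = 0 := by decide
  exact (h β).imp_left fun ⟨c, hc⟩ => IsUnit.of_mul_eq_one c hc

theorem ZMod.isUnit_or_mul_four {β : ZMod 8} : IsUnit β ∨ 4 * β = 0 := by
  have h : ∀ β : ZMod 8, (∃ c, β * c = 1) ∨ 4 * β = 0 := by decide
  exact (h β).imp_left fun ⟨c, hc⟩ => IsUnit.of_mul_eq_one c hc

/-- A finite check of the Fourier self-duality. -/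
theorem fourierSelfDual_of_tables {P : ℕ} [NeZero P] {χ : MulChar (ZMod P) ℤ}
    (hχ : χ.IsQuadratic)
    {m s g₁ g₂ : ZMod P} {K : ℤ} {T X Y : ZMod P → Prop}
    (hs0 : s ≠ 0) (hs : ∀ a, IsUnit a ∨ s * a = 0)
    (h2 : ∀ a, a * s = 0 ∨ a * s = s)
    (hχs : ∀ t, χ (t + s) = -χ t)
    (hT : ∀ z, T z ∨ T (z + s))
    (hX : ∀ x, ∃ x₀, X x₀ ∧ 2 * x = 2 * x₀ ∧ x ^ 2 = x₀ ^ 2)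
    (hY : ∀ y, ∃ y₀, Y y₀ ∧ 2 * m * y = 2 * m * y₀ ∧ m * y ^ 2 = m * y₀ ^ 2)
    (hG : ∀ z, T z → (∑ x, ∑ y, if x ^ 2 - m * y ^ 2 = z then 1 else 0 : ℤ) -
        (∑ x, ∑ y, if x ^ 2 - m * y ^ 2 = z + s then 1 else 0 : ℤ) =
      K * ((if g₁ = z then 1 else 0) + if g₂ = z then 1 else 0) -
        K * ((if g₁ = z + s then 1 else 0) + if g₂ = z + s then 1 else 0))
    (h₁ : ∀ β, s * β = 0 ∨ ∀ z, T z →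
      (∑ x, ∑ y, if β * (x ^ 2 - m * y ^ 2) = z then 1 else 0 : ℤ) -
        (∑ x, ∑ y, if β * (x ^ 2 - m * y ^ 2) = z + s then 1 else 0 : ℤ) =
      χ β * K * ((if g₁ = z then 1 else 0) + if g₂ = z then 1 else 0) -
        χ β * K * ((if g₁ = z + s then 1 else 0) + if g₂ = z + s then 1 else 0))
    (h₂ : ∀ β, s * β = 0 → ∀ x', X x' → ∀ y', Y y' → ∀ z, T z →
      (∑ x, ∑ y, if β * (x ^ 2 - m * y ^ 2) - (2 * x' * x - 2 * m * y' * y) = z then 1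
          else 0 : ℤ) -
        (∑ x, ∑ y, if β * (x ^ 2 - m * y ^ 2) - (2 * x' * x - 2 * m * y' * y) = z + s then 1
          else 0 : ℤ) =
      2 * (K * ((if (g₁ - z) * β = x' ^ 2 - m * y' ^ 2 then χ (g₁ - z) else 0) +
        if (g₂ - z) * β = x' ^ 2 - m * y' ^ 2 then χ (g₂ - z) else 0)))
    (h₃ : ∀ α, s * α = 0 → ∀ x', X x' → ∀ y', Y y' → ∀ z, T z →
      2 * (∑ x, ∑ y, if (z + (2 * x' * x - 2 * m * y' * y)) * α = x ^ 2 - m * y ^ 2 then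
        χ (z + (2 * x' * x - 2 * m * y' * y)) else 0 : ℤ) =
      K * ((if g₁ - α * (x' ^ 2 - m * y' ^ 2) = z then 1 else 0) +
        if g₂ - α * (x' ^ 2 - m * y' ^ 2) = z then 1 else 0) -
      K * ((if g₁ - α * (x' ^ 2 - m * y' ^ 2) = z + s then 1 else 0) +
        if g₂ - α * (x' ^ 2 - m * y' ^ 2) = z + s then 1 else 0)) :
    FourierSelfDual 1 0 (-m) (unitWeight χ 1) := by
  have hs' : ∀ a, ¬ IsUnit a → s * a = 0 := fun a ha => (hs a).resolve_left ha
  have hss : s + s = 0 := by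
    rcases h2 2 with h' | h'
    · rw [← two_mul, h']
    · exact absurd (by linear_combination h') hs0
  have hpt : ∀ (Ψ : ZMod P → ℂ) (k : ℤ) (u v : ZMod P),
      ∑ z, ((k * ((if u = z then 1 else 0) + if v = z then 1 else 0) : ℤ) : ℂ) * Ψ z =
        k * (Ψ u + Ψ v) := by
    intro Ψ k u v
    push_cast
    simp only [mul_assoc, ← Finset.mul_sum, add_mul, Finset.sum_add_distrib, ite_mul, one_mul,
      zero_mul, Finset.sum_ite_eq, Finset.mem_univ, if_true]
  have hanti : ∀ Ψ : AddChar (ZMod P) ℂ, Ψ.IsPrimitive → ∀ z, Ψ (z + s) = -Ψ z :=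
    fun Ψ hΨ => hΨ.antiperiodic hs0 h2
  have hgauss : ∀ Ψ : AddChar (ZMod P) ℂ, Ψ.IsPrimitive →
      ∑ x, ∑ y, Ψ (x ^ 2 - m * y ^ 2) = K * (Ψ g₁ + Ψ g₂) := by
    intro Ψ hΨ
    rw [← Fintype.sum_prod_type', sum_comp_eq_sum_card, ← hpt]
    refine sum_eq_of_antiperiodic hss (hanti Ψ hΨ) hT ?_
    simpa only [Fintype.sum_prod_type] using hG
  refine fourierSelfDual_diagonal hχ (s := s) (fun a ha => by rw [mul_comm, hs' a ha]) hχs ?_ ?_ ?_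
  · intro Ψ hΨ β hβ
    have hβ' : s * β ≠ 0 := by
      obtain ⟨u, rfl⟩ := hβ
      simpa using hs0
    rw [hgauss Ψ hΨ, ← mul_assoc, ← Int.cast_mul, ← Fintype.sum_prod_type', sum_comp_eq_sum_card,
      ← hpt]
    refine sum_eq_of_antiperiodic hss (hanti Ψ hΨ) hT ?_
    simpa only [Fintype.sum_prod_type] using (h₁ β).resolve_left hβ'
  · intro Ψ hΨ β hβ x' y'
    obtain ⟨x₀, hx₀, hx1, hx2⟩ := hX x'
    obtain ⟨y₀, hy₀, hy1, hy2⟩ := hY y'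
    have e1 : ∀ x y : ZMod P, 2 * x * x' - 2 * m * y * y' = 2 * x₀ * x - 2 * m * y₀ * y :=
      fun x y => by linear_combination x * hx1 - y * hy1
    simp only [e1, hx2, hy2]
    have e2 : ∑ x, ∑ y, Ψ (β * (x ^ 2 - m * y ^ 2) - (2 * x₀ * x - 2 * m * y₀ * y)) =
      ∑ z, ((K * ((if (g₁ - z) * β = x₀ ^ 2 - m * y₀ ^ 2 then χ (g₁ - z) else 0) +
        if (g₂ - z) * β = x₀ ^ 2 - m * y₀ ^ 2 then χ (g₂ - z) else 0) : ℤ) : ℂ) * Ψ z := by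
      rw [← Fintype.sum_prod_type', sum_comp_eq_sum_card]
      refine sum_eq_of_antiperiodic hss (hanti Ψ hΨ) hT ?_
      intro z hz
      simp only [Fintype.sum_prod_type]
      rw [h₂ β (hs' β hβ) x₀ hx₀ y₀ hy₀ z hz]
      have e3 : ∀ g : ZMod P, (if (g - (z + s)) * β = x₀ ^ 2 - m * y₀ ^ 2 then χ (g - (z + s))
          else 0) = -(if (g - z) * β = x₀ ^ 2 - m * y₀ ^ 2 then χ (g - z) else 0) := by
        intro g
        have e4 : g - (z + s) = (g - z) + s := by linear_combination -hss
        rw [e4, hχs, add_mul, hs' β hβ, add_zero]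
        split_ifs <;> ring
      rw [e3, e3]
      ring
    rw [e2, hgauss Ψ hΨ]
    have e5 : ∀ g : ZMod P, Ψ g * ∑ t, (if t * β = x₀ ^ 2 - m * y₀ ^ 2 then (χ t : ℂ) else 0) *
        Ψ (-t) = ∑ z, (if (g - z) * β = x₀ ^ 2 - m * y₀ ^ 2 then (χ (g - z) : ℂ) else 0) * Ψ z := by
      intro g
      rw [← Equiv.sum_comp (Equiv.subLeft g), Finset.mul_sum]
      refine Finset.sum_congr rfl fun z _ => ?_
      rw [Equiv.subLeft_apply, mul_left_comm, ← AddChar.map_add_eq_mul]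
      congr 2
      ring
    push_cast
    rw [mul_assoc, add_mul, e5, e5]
    simp only [mul_assoc, ← Finset.mul_sum, add_mul, Finset.sum_add_distrib]
  · intro Ψ hΨ α hα x' y'
    obtain ⟨x₀, hx₀, hx1, hx2⟩ := hX x'
    obtain ⟨y₀, hy₀, hy1, hy2⟩ := hY y'
    have e1 : ∀ x y : ZMod P, 2 * x * x' - 2 * m * y * y' = 2 * x₀ * x - 2 * m * y₀ * y :=
      fun x y => by linear_combination x * hx1 - y * hy1
    simp only [e1, hx2, hy2]
    have e2 : ∀ x y : ZMod P, ∑ t, (if t * α = x ^ 2 - m * y ^ 2 then (χ t : ℂ) else 0) *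
        Ψ (t - (2 * x₀ * x - 2 * m * y₀ * y)) =
        ∑ z, ((if (z + (2 * x₀ * x - 2 * m * y₀ * y)) * α = x ^ 2 - m * y ^ 2 then
          χ (z + (2 * x₀ * x - 2 * m * y₀ * y)) else 0 : ℤ) : ℂ) * Ψ z := by
      intro x y
      rw [← Equiv.sum_comp (Equiv.addRight (2 * x₀ * x - 2 * m * y₀ * y))]
      refine Finset.sum_congr rfl fun z _ => ?_
      rw [Equiv.coe_addRight, add_sub_cancel_right]
      push_cast
      rfl
    refine Eq.trans (Finset.sum_congr rfl fun x _ => Finset.sum_congr rfl fun y _ =>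
      Eq.trans ?_ (e2 x y)) ?_
    · congr!
    have e3 : ∀ f : ZMod P → ZMod P → ZMod P → ℤ, ∑ x, ∑ y, ∑ z, (f x y z : ℂ) * Ψ z =
        ∑ z, ((∑ x, ∑ y, f x y z : ℤ) : ℂ) * Ψ z := by
      intro f
      rw [← Fintype.sum_prod_type' (f := fun x y => ∑ z, (f x y z : ℂ) * Ψ z), Finset.sum_comm]
      refine Finset.sum_congr rfl fun z _ => ?_
      rw [← Finset.sum_mul, Fintype.sum_prod_type]
      push_cast
      rfl
    rw [e3, hgauss Ψ hΨ, mul_assoc (K : ℂ), add_mul, ← AddChar.map_add_eq_mul,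
      ← AddChar.map_add_eq_mul,
      ← sub_eq_add_neg, ← sub_eq_add_neg, ← hpt]
    refine sum_eq_of_antiperiodic hss (hanti Ψ hΨ) hT ?_
    intro z hz
    rw [← h₃ α (hs' α hα) x₀ hx₀ y₀ hy₀ z hz]
    refine Eq.trans (congrArg₂ _ rfl ?_) ((sub_neg_eq_add _ _).trans (two_mul _).symm)
    simp only [← Finset.sum_neg_distrib]
    refine Finset.sum_congr rfl fun x _ => Finset.sum_congr rfl fun y _ => ?_
    rw [add_right_comm, hχs, add_mul _ s, hs' α hα, add_zero]
    split_ifs <;> ring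

theorem fourierSelfDual_four : FourierSelfDual 1 0 (-3) (unitWeight ZMod.χ₄ 1) := by
  refine fourierSelfDual_of_tables (s := 2) (g₁ := 1) (g₂ := 1) (K := 4) (T := fun _ => True)
    (X := fun _ => True) (Y := fun _ => True) ZMod.isQuadratic_χ₄ ?_
    (fun a => ZMod.isUnit_or_mul_two) ?_ ?_ ?_ ?_ ?_ ?_ ?_ ?_ ?_
  all_goals decide +kernel

theorem fourierSelfDual_eight : FourierSelfDual 1 0 (-2) (unitWeight ZMod.χ₈ 1) := by
  refine fourierSelfDual_of_tables (s := 4) (g₁ := 1) (g₂ := -1) (K := 16)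
    (T := fun z => z.val < 4) (X := fun x => x.val < 4) (Y := fun y => y.val < 2)
    ZMod.isQuadratic_χ₈ ?_ (fun a => ZMod.isUnit_or_mul_four) ?_ ?_ ?_ ?_ ?_ ?_ ?_ ?_ ?_
  all_goals decide +kernel

theorem fourierSelfDual_eight' : FourierSelfDual 1 0 (-6) (unitWeight ZMod.χ₈' 1) := by
  refine fourierSelfDual_of_tables (s := 4) (g₁ := 1) (g₂ := 3) (K := 16)
    (T := fun z => z.val < 4) (X := fun x => x.val < 4) (Y := fun y => y.val < 2)
    ZMod.isQuadratic_χ₈' ?_ (fun a => ZMod.isUnit_or_mul_four) ?_ ?_ ?_ ?_ ?_ ?_ ?_ ?_ ?_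
  all_goals decide +kernel

/-- The component at `p` of the quadratic character of discriminant `Δ`. -/
def genusChi (Δ : ℤ) (p : ℕ) (a : ℤ) : ℤ :=
  if p = 2 then
    if Δ / 4 % 4 = 3 then ZMod.χ₄ a else if Δ / 4 % 8 = 2 then ZMod.χ₈ a else ZMod.χ₈' a
  else jacobiSym a p

/-- The local factor at `p` of the generalized genus character on the vector `[-t, k, -Nβ]`. -/
def genusWeight (Δ A : ℤ) (p : ℕ) (t β : ℤ) : ℂ :=
  if (p : ℤ) ∣ β then genusChi Δ p (A * t) else genusChi Δ p β

/-- A unit at `p` represented by the form `[N, r, C]`. -/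
def unitCoeff (N C : ℤ) (p : ℕ) : ℤ := if (p : ℤ) ∣ N then C else N

theorem IsFundamentalDiscriminant.factorization {Δ : ℤ} (hΔ : IsFundamentalDiscriminant Δ) {p : ℕ}
    (hp : p.Prime) (hpΔ : (p : ℤ) ∣ Δ) :
    (p ≠ 2 ∧ ¬ ((p : ℤ) ^ 2 ∣ Δ) ∧ p ^ Δ.natAbs.factorization p = p) ∨
      (p = 2 ∧ Δ = 4 * (Δ / 4) ∧ Δ / 4 % 4 = 3 ∧ p ^ Δ.natAbs.factorization p = 4) ∨
      (p = 2 ∧ Δ = 4 * (Δ / 4) ∧ Δ / 4 % 4 = 2 ∧ p ^ Δ.natAbs.factorization p = 8) := by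
  have h0 := hΔ.ne_zero
  have hf : ∀ k : ℕ, (p : ℤ) ^ k ∣ Δ → ¬ (p : ℤ) ^ (k + 1) ∣ Δ →
      Δ.natAbs.factorization p = k := by
    intro k h1 h2
    have h3 : p ^ k ∣ Δ.natAbs := by
      rw [← Int.natCast_dvd]; exact_mod_cast h1
    have h4 : ¬ p ^ (k + 1) ∣ Δ.natAbs := by
      rw [← Int.natCast_dvd]; exact_mod_cast h2
    rw [hp.pow_dvd_iff_le_factorization (by simpa using h0)] at h3 h4
    omega
  by_cases hp2 : p = 2
  · subst hp2
    right
    rcases hΔ with ⟨h, -⟩ | ⟨h, hsq, hm⟩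
    · push_cast at hpΔ
      omega
    · have e : Δ = 4 * (Δ / 4) := by omega
      rcases hm with hm | hm
      · right
        refine ⟨rfl, e, hm, ?_⟩
        rw [hf 3 (by push_cast; omega) (by push_cast; omega)]
        norm_num
      · left
        refine ⟨rfl, e, hm, ?_⟩
        rw [hf 2 (by push_cast; omega) (by push_cast; omega)]
        norm_num
  · left
    have h2 : ¬ ((p : ℤ) ^ 2 ∣ Δ) := by
      have hpi := Nat.prime_iff_prime_int.1 hp
      have hsf : ∀ m : ℤ, Squarefree m → ¬ (p : ℤ) ^ 2 ∣ m := by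
        intro m hm h
        exact hpi.not_isUnit (hm p (by rwa [← pow_two]))
      rcases hΔ with ⟨h, hsq⟩ | ⟨h, hsq, hm⟩
      · exact hsf _ hsq
      · intro h3
        refine hsf _ hsq ?_
        have e : Δ = 4 * (Δ / 4) := by omega
        rw [e] at h3
        refine IsCoprime.dvd_of_dvd_mul_left ?_ h3
        refine IsCoprime.pow_left ?_
        rw [Int.isCoprime_iff_gcd_eq_one]
        have := (Nat.coprime_primes hp Nat.prime_two).2 hp2
        exact (Nat.Coprime.pow_right 2 this : Nat.Coprime p (2 ^ 2))
    refine ⟨hp2, h2, ?_⟩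
    rw [hf 1 (by simpa using hpΔ) h2, pow_one]

theorem IsFundamentalDiscriminant.not_sq_dvd {Δ : ℤ} (hΔ : IsFundamentalDiscriminant Δ)
    {N r C : ℤ} (hC : r ^ 2 - Δ = 4 * N * C) {p : ℕ} (hp : p.Prime) (hpΔ : (p : ℤ) ∣ Δ) :
    ¬ (p : ℤ) ^ 2 ∣ N * C := by
  intro h
  have hpi := Nat.prime_iff_prime_int.1 hp
  have h2 : (p : ℤ) ∣ r := by
    refine hpi.dvd_of_dvd_pow (n := 2) ?_
    have : r ^ 2 = Δ + 4 * (N * C) := by linarith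
    rw [this]
    exact dvd_add hpΔ (Dvd.dvd.mul_left ((dvd_pow_self _ two_ne_zero).trans h) _)
  rcases hΔ.factorization hp hpΔ with ⟨-, h3, -⟩ | ⟨h3, h4, h5, -⟩ | ⟨h3, h4, h5, -⟩
  · refine h3 ?_
    have : Δ = r ^ 2 - 4 * (N * C) := by linarith
    rw [this]
    exact dvd_sub (pow_dvd_pow_of_dvd h2 2) (Dvd.dvd.mul_left h _)
  all_goals
    subst h3
    obtain ⟨s, rfl⟩ := h2
    obtain ⟨u, hu⟩ := h
    push_cast at hu hC
    have h6 : Δ / 4 = s ^ 2 - 4 * u := by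
      have : 4 * (Δ / 4) = 4 * (s ^ 2 - 4 * u) := by rw [← h4]; linarith
      linarith
    rw [h6] at h5
    rcases Int.even_or_odd' s with ⟨v, rfl | rfl⟩
    · ring_nf at h5; omega
    · ring_nf at h5; omega

theorem unitCoeff_not_dvd {Δ : ℤ} (hΔ : IsFundamentalDiscriminant Δ)
    {N r C : ℤ} (hC : r ^ 2 - Δ = 4 * N * C) {p : ℕ} (hp : p.Prime) (hpΔ : (p : ℤ) ∣ Δ) :
    ¬ (p : ℤ) ∣ unitCoeff N C p := by
  rw [unitCoeff]
  split_ifs with h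
  · intro h2
    refine hΔ.not_sq_dvd hC hp hpΔ ?_
    rw [pow_two]
    exact mul_dvd_mul h h2
  · exact h

theorem FourierSelfDual.of_unit {R : Type*} [CommRing R] [Fintype R] {χ : MulChar R ℤ}
    (hχ : χ.IsQuadratic) {m : R} (h : FourierSelfDual 1 0 (-m) (unitWeight χ 1))
    (hsq : ∀ u : R, IsUnit u → u * u = 1) {A s C : R} (hA : IsUnit A) (hm : m = s ^ 2 - A * C) :
    FourierSelfDual A (2 * s) C (unitWeight χ A) := by
  obtain ⟨u, rfl⟩ := hA
  have hu := hsq u u.isUnit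
  have h1 := h.of_diagonal hχ u (u * s)
  have e1 : 2 * (u : R) * (u * s) = 2 * s := by linear_combination 2 * s * hu
  have e2 : (u : R) * ((u * s) ^ 2 - m) = C := by
    rw [hm]
    linear_combination (u * s ^ 2 + C) * hu
  rwa [e1, e2] at h1

theorem fourierSelfDual_genusWeight_odd {p : ℕ} [Fact p.Prime] (hp2 : p ≠ 2) {Δ A B C : ℤ}
    (hΔ : (p : ℤ) ∣ Δ) (hC : B ^ 2 - Δ = 4 * A * C) (hA : ¬ (p : ℤ) ∣ A) :
    FourierSelfDual (A : ZMod p) (B : ZMod p) (C : ZMod p)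
      (fun t β => genusWeight Δ A p t.cast β.cast) := by
  have hA' : (A : ZMod p) ≠ 0 := by rwa [Ne, ZMod.intCast_zmod_eq_zero_iff_dvd]
  have hdisc : (B : ZMod p) ^ 2 = 4 * A * C := by
    have h1 := congrArg (fun z : ℤ => (z : ZMod p)) hC
    have h2 := (ZMod.intCast_zmod_eq_zero_iff_dvd Δ p).2 hΔ
    push_cast at h1
    rw [h2, sub_zero] at h1
    exact h1
  have h := fourierSelfDual_field (by rwa [ZMod.ringChar_zmod_n]) hA' hdisc
  have e : (fun t β : ZMod p => genusWeight Δ A p t.cast β.cast) = fieldWeight (A : ZMod p) := ?_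
  · rw [e]
    exact h
  funext t β
  have e1 : ((p : ℤ) ∣ (β.cast : ℤ)) ↔ β = 0 := by
    rw [← ZMod.intCast_zmod_eq_zero_iff_dvd, ZMod.intCast_zmod_cast]
  have e2 : ∀ a : ℤ, (genusChi Δ p a : ℂ) = quadCharC (ZMod p) a := by
    intro a
    rw [genusChi, if_neg hp2, ← jacobiSym.legendreSym.to_jacobiSym, quadCharC_apply, legendreSym]
    congr!
  rw [genusWeight, fieldWeight, e2, e2]
  push_cast
  simp only [e1]
  split_ifs <;> rfl

theorem fourierSelfDual_genusWeight_two {P : ℕ} [NeZero P] {χ : MulChar (ZMod P) ℤ}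
    (hχ : χ.IsQuadratic) {Δ A B C m : ℤ}
    (h : FourierSelfDual 1 0 (-(m : ZMod P)) (unitWeight χ 1))
    (hunit : ∀ a : ℤ, IsUnit (a : ZMod P) ↔ ¬ 2 ∣ a)
    (hsq : ∀ u : ZMod P, IsUnit u → u * u = 1) 
    (hgen : ∀ a : ℤ, genusChi Δ 2 a = χ a)
    (hm : (m : ZMod P) = ((Δ / 4 : ℤ) : ZMod P)) (hΔ : Δ = 4 * (Δ / 4))
    (hC : B ^ 2 - Δ = 4 * A * C) (hA : ¬ (2 : ℤ) ∣ A) :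
    FourierSelfDual (A : ZMod P) (B : ZMod P) (C : ZMod P)
      (fun t β => genusWeight Δ A 2 t.cast β.cast) := by
  have hB : (2 : ℤ) ∣ B := by
    refine Int.prime_two.dvd_of_dvd_pow (n := 2) ?_
    have : B ^ 2 = 2 * (2 * (Δ / 4) + 2 * A * C) := by linarith
    rw [this]
    exact dvd_mul_right _ _
  obtain ⟨s, rfl⟩ := hB
  have h4 : Δ / 4 = s ^ 2 - A * C := by
    have : 4 * (Δ / 4) = 4 * (s ^ 2 - A * C) := by rw [← hΔ]; linarith
    linarith
  have h5 := h.of_unit hχ hsq (A := A) (s := s) (C := C) ((hunit A).2 hA) (by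
    rw [hm, h4]; push_cast; ring)
  push_cast
  convert h5 using 1
  funext t β
  have e1 : ((2 : ℤ) ∣ (β.cast : ℤ)) ↔ ¬ IsUnit β := by
    have := hunit β.cast
    rw [ZMod.intCast_zmod_cast] at this
    rw [this, not_not]
  rw [genusWeight, unitWeight, hgen, hgen]
  push_cast
  simp only [e1]
  split_ifs <;> rfl

theorem ZMod.isUnit_intCast_two_pow {k : ℕ} (hk : k ≠ 0) (a : ℤ) :
    IsUnit (a : ZMod (2 ^ k)) ↔ ¬ 2 ∣ a := by
  rw [ZMod.coe_int_isUnit_iff_isCoprime]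
  push_cast
  rw [IsCoprime.pow_left_iff (Nat.pos_of_ne_zero hk), Int.prime_two.coprime_iff_not_dvd]

theorem ZMod.mul_self_of_isUnit_four (u : ZMod 4) (hu : IsUnit u) : u * u = 1 := by
  have h : ∀ u c : ZMod 4, u * c = 1 → u * u = 1 := by decide
  obtain ⟨c, hc⟩ := isUnit_iff_exists_inv.1 hu
  exact h u c hc

theorem ZMod.mul_self_of_isUnit_eight (u : ZMod 8) (hu : IsUnit u) : u * u = 1 := by
  have h : ∀ u c : ZMod 8, u * c = 1 → u * u = 1 := by decide
  obtain ⟨c, hc⟩ := isUnit_iff_exists_inv.1 hu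
  exact h u c hc

theorem fourierSelfDual_genusWeight {Δ : ℤ} (hΔ : IsFundamentalDiscriminant Δ)
    {N r C : ℤ} (hC : r ^ 2 - Δ = 4 * N * C) {p : ℕ} (hp : p.Prime) (hpΔ : (p : ℤ) ∣ Δ)
    {P : ℕ} [NeZero P] (hP : P = p ^ Δ.natAbs.factorization p) :
    FourierSelfDual (N : ZMod P) (r : ZMod P) (C : ZMod P)
      (fun t β => genusWeight Δ (unitCoeff N C p) p t.cast β.cast) := by
  have key : ∀ {A C' : ℤ}, ¬ (p : ℤ) ∣ A → r ^ 2 - Δ = 4 * A * C' →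
      FourierSelfDual (A : ZMod P) (r : ZMod P) (C' : ZMod P)
        (fun t β => genusWeight Δ A p t.cast β.cast) := by
    intro A C' hA hC'
    rcases hΔ.factorization hp hpΔ with ⟨h2, -, h3⟩ | ⟨rfl, h4, h5, h3⟩ | ⟨rfl, h4, h5, h3⟩
    · rw [h3] at hP
      subst hP
      have : Fact P.Prime := ⟨hp⟩
      convert fourierSelfDual_genusWeight_odd h2 hpΔ hC' hA
    · rw [h3] at hP
      subst hP
      refine fourierSelfDual_genusWeight_two (χ := ZMod.χ₄) (m := 3) ZMod.isQuadratic_χ₄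
        (by simpa using fourierSelfDual_four) (ZMod.isUnit_intCast_two_pow (k := 2) two_ne_zero)
        ZMod.mul_self_of_isUnit_four ?_ ?_ h4 hC' hA
      · intro a
        rw [genusChi, if_pos rfl, if_pos h5]
      · rw [ZMod.intCast_eq_intCast_iff]
        exact h5.symm
    · rw [h3] at hP
      subst hP
      have h6 : Δ / 4 % 8 = 2 ∨ Δ / 4 % 8 = 6 := by omega
      rcases h6 with h6 | h6
      · refine fourierSelfDual_genusWeight_two (χ := ZMod.χ₈) (m := 2) ZMod.isQuadratic_χ₈
          (by simpa using fourierSelfDual_eight)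
          (ZMod.isUnit_intCast_two_pow (k := 3) three_ne_zero)
          ZMod.mul_self_of_isUnit_eight ?_ ?_ h4 hC' hA
        · intro a
          rw [genusChi, if_pos rfl, if_neg (by omega), if_pos h6]
        · rw [ZMod.intCast_eq_intCast_iff]
          exact h6.symm
      · refine fourierSelfDual_genusWeight_two (χ := ZMod.χ₈') (m := 6) ZMod.isQuadratic_χ₈'
          (by simpa using fourierSelfDual_eight')
          (ZMod.isUnit_intCast_two_pow (k := 3) three_ne_zero)
          ZMod.mul_self_of_isUnit_eight ?_ ?_ h4 hC' hA
        · intro a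
          rw [genusChi, if_pos rfl, if_neg (by omega), if_neg (by omega)]
        · rw [ZMod.intCast_eq_intCast_iff]
          exact h6.symm
  have hA := unitCoeff_not_dvd hΔ hC hp hpΔ
  rw [unitCoeff] at hA ⊢
  split_ifs at hA ⊢
  · exact (key hA (by linarith)).swap
  · exact key hA hC

theorem genusChi_congr {Δ : ℤ} (hΔ : IsFundamentalDiscriminant Δ) {p : ℕ} (hp : p.Prime)
    (hpΔ : (p : ℤ) ∣ Δ) {a b : ℤ} (h : a ≡ b [ZMOD (p ^ Δ.natAbs.factorization p : ℕ)]) :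
    genusChi Δ p a = genusChi Δ p b := by
  rcases hΔ.factorization hp hpΔ with ⟨h2, -, h3⟩ | ⟨rfl, h4, h5, h3⟩ | ⟨rfl, h4, h5, h3⟩
  · rw [h3] at h
    rw [genusChi, genusChi, if_neg h2, if_neg h2, jacobiSym.mod_left a, h, ← jacobiSym.mod_left]
  · rw [h3] at h
    rw [genusChi, genusChi, if_pos rfl, if_pos rfl, if_pos h5, if_pos h5,
      (ZMod.intCast_eq_intCast_iff a b 4).2 h]
  · rw [h3] at h
    have h6 : ¬ Δ / 4 % 4 = 3 := by omega
    rw [genusChi, genusChi, if_pos rfl, if_pos rfl, if_neg h6, if_neg h6,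
      (ZMod.intCast_eq_intCast_iff a b 8).2 h]

theorem prime_dvd_pow_factorization {D p : ℕ} (hD : D ≠ 0) (hp : p.Prime) (hpD : p ∣ D) :
    p ∣ p ^ D.factorization p :=
  dvd_pow_self p (hp.factorization_pos_of_dvd hD hpD).ne'

theorem genusWeight_congr {Δ : ℤ} (hΔ : IsFundamentalDiscriminant Δ) {p : ℕ} (hp : p.Prime)
    (hpΔ : (p : ℤ) ∣ Δ) (A : ℤ) {t t' β β' : ℤ}
    (ht : t ≡ t' [ZMOD (p ^ Δ.natAbs.factorization p : ℕ)])
    (hβ : β ≡ β' [ZMOD (p ^ Δ.natAbs.factorization p : ℕ)]) :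
    genusWeight Δ A p t β = genusWeight Δ A p t' β' := by
  have h0 : Δ.natAbs ≠ 0 := by simpa using hΔ.ne_zero
  have h1 : ((p : ℤ) ∣ β) ↔ (p : ℤ) ∣ β' := by
    have := hβ.of_dvd (m := p) (by
      exact_mod_cast prime_dvd_pow_factorization h0 hp (by rwa [← Int.natCast_dvd]))
    exact this.dvd_iff
  rw [genusWeight, genusWeight, genusChi_congr hΔ hp hpΔ hβ,
    genusChi_congr hΔ hp hpΔ (ht.mul_left A)]
  simp only [h1]

/-- The product of the local factors of the generalized genus character. -/
def genusProd (Δ N C t β : ℤ) : ℂ :=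
  ∏ p ∈ Δ.natAbs.primeFactors, genusWeight Δ (unitCoeff N C p) p t β

theorem mem_primeFactors_natAbs {Δ : ℤ} {p : ℕ} (h : p ∈ Δ.natAbs.primeFactors) :
    p.Prime ∧ (p : ℤ) ∣ Δ :=
  ⟨Nat.prime_of_mem_primeFactors h, Int.natCast_dvd.2 (Nat.dvd_of_mem_primeFactors h)⟩

theorem fourierSelfDual_genusProd {Δ : ℤ} (hΔ : IsFundamentalDiscriminant Δ) {N r C : ℤ}
    (hC : r ^ 2 - Δ = 4 * N * C) [NeZero Δ.natAbs] :
    FourierSelfDual (N : ZMod Δ.natAbs) (r : ZMod Δ.natAbs) (C : ZMod Δ.natAbs)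
      (fun t β => genusProd Δ N C t.cast β.cast) := by
  have h0 : Δ.natAbs ≠ 0 := NeZero.ne _
  have : ∀ p : Δ.natAbs.primeFactors, NeZero (p.1 ^ Δ.natAbs.factorization p.1) := fun p =>
    ⟨pow_ne_zero _ (mem_primeFactors_natAbs p.2).1.ne_zero⟩
  have h1 := FourierSelfDual.pi fun p : Δ.natAbs.primeFactors =>
    fourierSelfDual_genusWeight hΔ hC (mem_primeFactors_natAbs p.2).1
      (mem_primeFactors_natAbs p.2).2 rfl
  have hf : ∀ a : ℤ, ZMod.equivPi _ h0 (a : ZMod Δ.natAbs) = fun p => (a : ZMod _) := by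
    intro a
    rw [map_intCast]
    rfl
  have h2 := FourierSelfDual.of_ringEquiv (ZMod.equivPi _ h0) (A := (N : ZMod Δ.natAbs))
    (B := (r : ZMod Δ.natAbs)) (C := (C : ZMod Δ.natAbs)) (by rw [hf, hf, hf]; exact h1)
  have e : (fun t β : ZMod Δ.natAbs => genusProd Δ N C t.cast β.cast) =
      fun t β => ∏ p : Δ.natAbs.primeFactors, genusWeight Δ (unitCoeff N C p) p
        (ZMod.equivPi _ h0 t p).cast (ZMod.equivPi _ h0 β p).cast := ?_
  · rw [e]
    exact h2
  funext t β
  rw [genusProd, ← Finset.prod_coe_sort]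
  refine Finset.prod_congr rfl fun p _ => ?_
  have h3 : ∀ t : ZMod Δ.natAbs, (t.cast : ℤ) ≡ (ZMod.equivPi _ h0 t p).cast
      [ZMOD (p.1 ^ Δ.natAbs.factorization p.1 : ℕ)] := by
    intro t
    rw [← ZMod.intCast_eq_intCast_iff, ZMod.intCast_zmod_cast]
    conv_rhs => rw [← ZMod.intCast_zmod_cast t, hf]
  exact genusWeight_congr hΔ (mem_primeFactors_natAbs p.2).1 (mem_primeFactors_natAbs p.2).2 _
    (h3 t) (h3 β)

theorem genusProd_congr {Δ : ℤ} (hΔ : IsFundamentalDiscriminant Δ) (N C : ℤ) {t t' β β' : ℤ}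
    (ht : t ≡ t' [ZMOD Δ]) (hβ : β ≡ β' [ZMOD Δ]) :
    genusProd Δ N C t β = genusProd Δ N C t' β' := by
  refine Finset.prod_congr rfl fun p hp => ?_
  obtain ⟨h1, h2⟩ := mem_primeFactors_natAbs hp
  have h3 : ((p ^ Δ.natAbs.factorization p : ℕ) : ℤ) ∣ Δ :=
    Int.natCast_dvd.2 (Nat.ordProj_dvd _ _)
  exact genusWeight_congr hΔ h1 h2 _ (ht.of_dvd h3) (hβ.of_dvd h3)

/-- Quadratic reciprocity for odd integers of arbitrary signs. -/
theorem jacobiSym_natAbs_reciprocity {u n : ℤ} (hu : u % 2 = 1) (hn : n % 2 = 1) :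
    (if n < 0 ∧ u < 0 then -1 else 1) * jacobiSym u n.natAbs =
      (if u % 4 = 1 then 1 else ZMod.χ₄ n) * jacobiSym n u.natAbs := by
  obtain ⟨a, ha⟩ : ∃ a, a = n.natAbs := ⟨_, rfl⟩
  obtain ⟨b, hb⟩ : ∃ b, b = u.natAbs := ⟨_, rfl⟩
  have ha2 : a % 2 = 1 := by omega
  have hb2 : b % 2 = 1 := by omega
  have hq := jacobiSym.quadratic_reciprocity_if hb2 ha2
  have hna := fun z : ℤ => jacobiSym.neg z (Nat.odd_iff.2 ha2)
  have hnb := fun z : ℤ => jacobiSym.neg z (Nat.odd_iff.2 hb2)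
  rw [ZMod.χ₄_nat_eq_if_mod_four] at hna hnb
  rw [ZMod.χ₄_int_eq_if_mod_four, ← ha, ← hb]
  have hn' : n = a ∨ n = -a := by omega
  have hu' : u = b ∨ u = -b := by omega
  have ha0 : ¬ (a : ℤ) < 0 := by omega
  have ha0' : -(a : ℤ) < 0 := by omega
  have hb0 : ¬ (b : ℤ) < 0 := by omega
  have hb0' : -(b : ℤ) < 0 := by omega
  clear hn hu ha hb
  have ha4 : (a % 4 = 1 ∧ (a : ℤ) % 4 = 1 ∧ -(a : ℤ) % 4 = 3) ∨
    (a % 4 = 3 ∧ (a : ℤ) % 4 = 3 ∧ -(a : ℤ) % 4 = 1) := by omega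
  have hb4 : (b % 4 = 1 ∧ (b : ℤ) % 4 = 1 ∧ -(b : ℤ) % 4 = 3) ∨
    (b % 4 = 3 ∧ (b : ℤ) % 4 = 3 ∧ -(b : ℤ) % 4 = 1) := by omega
  have ha2' : (a : ℤ) % 2 ≠ 0 ∧ -(a : ℤ) % 2 ≠ 0 := by omega
  rcases ha4 with ⟨ha4, ha5, ha6⟩ | ⟨ha4, ha5, ha6⟩ <;>
    rcases hb4 with ⟨hb4, hb5, hb6⟩ | ⟨hb4, hb5, hb6⟩ <;>
    simp only [ha2, hb2, ha4, hb4, one_ne_zero, and_true, and_false, reduceIte,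
      OfNat.one_ne_ofNat, OfNat.ofNat_ne_one] at hq hna hnb <;>
    rcases hn' with rfl | rfl <;> rcases hu' with rfl | rfl <;>
    simp only [hna, hnb, ← hq, ha0, ha0', hb0, hb0', ha2', ha5, ha6, hb5, hb6, and_true,
      and_false, reduceIte, OfNat.ofNat_ne_one] <;> ring

theorem jacobiSym_prod_right (a : ℤ) {s : Finset ℕ} (hs : ∀ p ∈ s, p ≠ 0) :
    jacobiSym a (∏ p ∈ s, p) = ∏ p ∈ s, jacobiSym a p := by
  induction s using Finset.induction_on with
  | empty => simp
  | insert p s hp ih =>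
    rw [Finset.prod_insert hp, Finset.prod_insert hp, jacobiSym.mul_right' _ (hs p (by simp))
      (Finset.prod_ne_zero_iff.2 fun q hq => hs q (by simp [hq])),
      ih fun q hq => hs q (by simp [hq])]

theorem jacobiSym_eq_prod_genusChi (Δ a : ℤ) {M : ℕ} (hM : Squarefree M) (h2 : ¬ 2 ∣ M) :
    ∏ p ∈ M.primeFactors, genusChi Δ p a = jacobiSym a M := by
  conv_rhs => rw [← Nat.prod_primeFactors_of_squarefree hM]
  rw [jacobiSym_prod_right _ fun p hp => (Nat.prime_of_mem_primeFactors hp).ne_zero]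
  refine Finset.prod_congr rfl fun p hp => ?_
  rw [genusChi, if_neg]
  rintro rfl
  exact h2 (Nat.dvd_of_mem_primeFactors hp)

theorem prod_genusChi_even {Δ : ℤ} {M k : ℕ} (hk : k ≠ 0) (hΔ : Δ.natAbs = 2 ^ k * M)
    (hM : Squarefree M) (h2 : ¬ 2 ∣ M) (a : ℤ) :
    ∏ p ∈ Δ.natAbs.primeFactors, genusChi Δ p a = genusChi Δ 2 a * jacobiSym a M := by
  have h3 : Δ.natAbs.primeFactors = insert 2 M.primeFactors := by
    rw [hΔ, Nat.primeFactors_mul (by positivity) hM.ne_zero,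
      Nat.primeFactors_prime_pow hk Nat.prime_two]
    rfl
  rw [h3, Finset.prod_insert (fun h => h2 (Nat.dvd_of_mem_primeFactors h)),
    jacobiSym_eq_prod_genusChi Δ a hM h2]

theorem exists_odd_part {n : ℤ} (h0 : n ≠ 0) :
    ∃ n₁ : ℤ, n = 2 ^ n.natAbs.factorization 2 * n₁ ∧ n₁ % 2 = 1 ∧
      n.natAbs / 2 ^ n.natAbs.factorization 2 = n₁.natAbs ∧ (n < 0 ↔ n₁ < 0) := by
  have h1 := Nat.ordProj_mul_ordCompl_eq_self n.natAbs 2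
  have h2 := Nat.not_dvd_ordCompl Nat.prime_two (Int.natAbs_ne_zero.2 h0)
  have h3 : (n.sign * n.natAbs : ℤ) = n := Int.sign_mul_natAbs n
  have h4 : (n.natAbs : ℤ) = 2 ^ n.natAbs.factorization 2 *
      ((n.natAbs / 2 ^ n.natAbs.factorization 2 : ℕ) : ℤ) := by
    conv_lhs => rw [← h1]
    push_cast
    rfl
  generalize n.natAbs / 2 ^ n.natAbs.factorization 2 = b at *
  rcases lt_or_gt_of_ne h0 with h | h
  · rw [Int.sign_eq_neg_one_of_neg h] at h3
    exact ⟨-b, by linarith, by omega, by omega, by omega⟩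
  · rw [Int.sign_eq_one_of_pos h] at h3
    exact ⟨b, by linarith, by omega, by omega, by omega⟩

theorem jacobiSym_two_eq_kron2 {Δ : ℤ} (h : Δ % 4 = 1) : jacobiSym 2 Δ.natAbs = kron2 Δ := by
  rw [jacobiSym.at_two (Nat.odd_iff.2 (by omega)), ZMod.χ₈_nat_eq_if_mod_eight, kron2,
    if_neg (show ¬ Δ.natAbs % 2 = 0 by omega), if_neg (show ¬ Δ % 2 = 0 by omega)]
  by_cases h1 : Δ % 8 = 1 ∨ Δ % 8 = 7
  · rw [if_pos h1, if_pos (by omega)]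
  · rw [if_neg h1, if_neg (by omega)]

theorem chi_eight_natAbs (n : ℤ) : ZMod.χ₈ n.natAbs = ZMod.χ₈ n := by
  rw [ZMod.χ₈_nat_eq_if_mod_eight, ZMod.χ₈_int_eq_if_mod_eight]
  split_ifs <;> first | rfl | omega

theorem kronecker_eq_prod {Δ : ℤ} (hΔ : IsFundamentalDiscriminant Δ) {n : ℤ}
    (hn : Int.gcd n Δ = 1) :
    kronecker Δ n = ∏ p ∈ Δ.natAbs.primeFactors, genusChi Δ p n := by
  by_cases h0 : n = 0
  · subst h0
    simp only [Int.gcd_zero_left] at hn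
    rw [kronecker, if_pos rfl, if_pos (by omega), hn]
    simp
  rw [kronecker, if_neg h0]
  rcases hΔ with ⟨h4, hsq⟩ | ⟨h4, hsq, hm⟩
  · obtain ⟨n₁, h1, h2, h3, h5⟩ := exists_odd_part h0
    rw [jacobiSym_eq_prod_genusChi Δ n (Int.squarefree_natAbs.2 hsq) (by omega), h3]
    conv_rhs => rw [h1, jacobiSym.mul_left, jacobiSym.pow_left, jacobiSym_two_eq_kron2 h4]
    have := jacobiSym_natAbs_reciprocity (u := Δ) (n := n₁) (by omega) h2
    rw [if_pos h4, one_mul] at this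
    simp only [h5]
    rw [← this]
    ring
  · have hn2 : n % 2 = 1 := by
      by_contra h
      have : (2 : ℤ) ∣ Int.gcd n Δ := Int.dvd_coe_gcd (by omega) (by omega)
      rw [hn] at this
      norm_num at this
    have hv : n.natAbs.factorization 2 = 0 :=
      Nat.factorization_eq_zero_of_not_dvd (by omega)
    have hna : Odd n.natAbs := Nat.odd_iff.2 (by omega)
    rw [hv, pow_zero, pow_zero, Nat.div_one, mul_one]
    obtain ⟨m, hΔm⟩ : ∃ m, Δ = 4 * m := ⟨Δ / 4, by omega⟩
    have hmd : Δ / 4 = m := by omega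
    rw [hmd] at hsq hm
    have hs : Δ < 0 ↔ m < 0 := by omega
    rw [hΔm, jacobiSym.mul_left, jacobiSym.at_four hna, ← hΔm, one_mul]
    simp only [hs]
    rcases hm with hm | hm
    · obtain ⟨u, rfl⟩ : ∃ u, m = 2 * u := ⟨m / 2, by omega⟩
      have hs' : 2 * u < 0 ↔ u < 0 := by omega
      rw [prod_genusChi_even (k := 3) (M := u.natAbs) (by norm_num) (by omega)
        (Int.squarefree_natAbs.2 (hsq.of_mul_right)) (by omega), jacobiSym.mul_left,
        jacobiSym.at_two hna, chi_eight_natAbs]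
      have := jacobiSym_natAbs_reciprocity (u := u) (n := n) (by omega) hn2
      simp only [hs']
      rw [genusChi, if_pos rfl, hmd, if_neg (show ¬ 2 * u % 4 = 3 by omega),
        ZMod.χ₈'_int_eq_χ₄_mul_χ₈]
      split_ifs at this ⊢ <;> first | omega | linear_combination ZMod.χ₈ n * this
    · rw [prod_genusChi_even (k := 2) (M := m.natAbs) (by norm_num) (by omega)
        (Int.squarefree_natAbs.2 hsq) (by omega)]
      have := jacobiSym_natAbs_reciprocity (u := m) (n := n) (by omega) hn2
      rw [this, genusChi, if_pos rfl, hmd, if_pos hm,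
        if_neg (show ¬ m % 4 = 1 by omega)]

theorem genusChi_mul (Δ : ℤ) (p : ℕ) (a b : ℤ) :
    genusChi Δ p (a * b) = genusChi Δ p a * genusChi Δ p b := by
  simp only [genusChi]
  split_ifs
  · push_cast; rw [map_mul]
  · push_cast; rw [map_mul]
  · push_cast; rw [map_mul]
  · rw [jacobiSym.mul_left]

theorem genusChi_mul_self (Δ : ℤ) {p : ℕ} (hp : p.Prime) {a : ℤ} (h : ¬ (p : ℤ) ∣ a) :
    genusChi Δ p a * genusChi Δ p a = 1 := by
  simp only [genusChi]
  split_ifs with h2 <;> try subst h2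
  · rw [ZMod.χ₄_int_eq_if_mod_four]
    split_ifs <;> first | rfl | (push_cast at h; omega)
  · rw [ZMod.χ₈_int_eq_if_mod_eight]
    split_ifs <;> first | rfl | (push_cast at h; omega)
  · rw [ZMod.χ₈'_int_eq_if_mod_eight]
    split_ifs <;> first | rfl | (push_cast at h; omega)
  · rw [← sq, jacobiSym.sq_one]
    rwa [Int.gcd_comm, ← Int.isCoprime_iff_gcd_eq_one, Prime.coprime_iff_not_dvd
      (Nat.prime_iff_prime_int.1 hp)]

theorem genusChi_eq_zero (Δ : ℤ) {p : ℕ} (hp : p.Prime) {a : ℤ} (h : (p : ℤ) ∣ a) :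
    genusChi Δ p a = 0 := by
  simp only [genusChi]
  split_ifs with h2 <;> try subst h2
  · rw [ZMod.χ₄_int_eq_if_mod_four, if_pos (by push_cast at h; omega)]
  · rw [ZMod.χ₈_int_eq_if_mod_eight, if_pos (by push_cast at h; omega)]
  · rw [ZMod.χ₈'_int_eq_if_mod_eight, if_pos (by push_cast at h; omega)]
  · have : NeZero p := ⟨hp.ne_zero⟩
    rw [jacobiSym.eq_zero_iff_not_coprime]
    intro h3
    rw [Int.gcd_comm, ← Int.isCoprime_iff_gcd_eq_one, Prime.coprime_iff_not_dvd
      (Nat.prime_iff_prime_int.1 hp)] at h3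
    exact h3 h

theorem exists_modEq_pow_factorization {D : ℕ} (f : ℕ → ℕ) :
    ∃ x : ℤ, ∀ p ∈ D.primeFactors, x ≡ f p [ZMOD (p ^ D.factorization p : ℕ)] := by
  have h := Nat.chineseRemainderOfFinset f (fun p => p ^ D.factorization p) D.primeFactors
    (fun p hp => pow_ne_zero _ (Nat.prime_of_mem_primeFactors hp).ne_zero)
    (fun p hp q hq hpq => Nat.Coprime.pow _ _ ((Nat.coprime_primes
      (Nat.prime_of_mem_primeFactors hp) (Nat.prime_of_mem_primeFactors hq)).2 hpq))
  exact ⟨h.1, fun p hp => Int.natCast_modEq_iff.2 (h.2 p hp)⟩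

theorem gcd_eq_one_of_not_dvd {Δ n : ℤ} (h0 : Δ ≠ 0)
    (h : ∀ p ∈ Δ.natAbs.primeFactors, ¬ (p : ℤ) ∣ n) : Int.gcd n Δ = 1 := by
  by_contra h1
  obtain ⟨p, hp, hpd⟩ := Nat.exists_prime_and_dvd h1
  refine h p (Nat.mem_primeFactors.2 ⟨hp, hpd.trans (Nat.gcd_dvd_right _ _), by simpa using h0⟩) ?_
  exact (Int.natCast_dvd_natCast.2 hpd).trans (Int.gcd_dvd_left _ _)

theorem prime_dvd_iff_of_modEq {Δ : ℤ} (h0 : Δ ≠ 0) {p : ℕ} (hp : p ∈ Δ.natAbs.primeFactors)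
    {a b : ℤ} (h : a ≡ b [ZMOD (p ^ Δ.natAbs.factorization p : ℕ)]) :
    (p : ℤ) ∣ a ↔ (p : ℤ) ∣ b := by
  have h1 := prime_dvd_pow_factorization (by simpa using h0) (Nat.prime_of_mem_primeFactors hp)
    (Nat.dvd_of_mem_primeFactors hp)
  exact (h.of_dvd (Int.natCast_dvd_natCast.2 h1)).dvd_iff

/-- Evaluation of the generalized genus character as a product of local characters. -/
theorem IsGenusChar.eq_prod {N : ℕ} {Δ : ℤ} {χ : ℤ → ℤ → ℤ → ℤ} (hχ : IsGenusChar N Δ χ)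
    (hΔ : IsFundamentalDiscriminant Δ) {a b c s η N₁ N₂ : ℤ} (hQ : QD N a b c = Δ * s)
    (hs : s ≡ η ^ 2 [ZMOD (4 * (N : ℤ))]) (hN : N₁ * N₂ = N) (h₁ : 0 < N₁) (h₂ : 0 < N₂)
    (P : ℕ → Prop) (hP : ∀ p ∈ Δ.natAbs.primeFactors, P p → ¬ (p : ℤ) ∣ N₂ * c)
    (hP' : ∀ p ∈ Δ.natAbs.primeFactors, ¬ P p → ¬ (p : ℤ) ∣ N₁ * a) :
    χ a b c = ∏ p ∈ Δ.natAbs.primeFactors,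
      if P p then genusChi Δ p (N₂ * c) else genusChi Δ p (N₁ * a) := by
  have h0 := hΔ.ne_zero
  obtain ⟨x, hx⟩ := exists_modEq_pow_factorization (D := Δ.natAbs) fun p => if P p then 0 else 1
  obtain ⟨y, hy⟩ := exists_modEq_pow_factorization (D := Δ.natAbs) fun p => if P p then 1 else 0
  have hn1 : ∀ p ∈ Δ.natAbs.primeFactors, P p → N₁ * a * x ^ 2 + b * x * y + N₂ * c * y ^ 2 ≡
      N₂ * c [ZMOD (p ^ Δ.natAbs.factorization p : ℕ)] := by
    intro p hp h
    have hx := hx p hp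
    have hy := hy p hp
    simp only [if_pos h] at hx hy
    have := (((hx.pow 2).mul_left (N₁ * a)).add ((hx.mul_left b).mul hy)).add
      ((hy.pow 2).mul_left (N₂ * c))
    refine this.trans ?_
    norm_num
  have hn2 : ∀ p ∈ Δ.natAbs.primeFactors, ¬ P p → N₁ * a * x ^ 2 + b * x * y + N₂ * c * y ^ 2 ≡
      N₁ * a [ZMOD (p ^ Δ.natAbs.factorization p : ℕ)] := by
    intro p hp h
    have hx := hx p hp
    have hy := hy p hp
    simp only [if_neg h] at hx hy
    have := (((hx.pow 2).mul_left (N₁ * a)).add ((hx.mul_left b).mul hy)).add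
      ((hy.pow 2).mul_left (N₂ * c))
    refine this.trans ?_
    norm_num
  have hgcd : Int.gcd (N₁ * a * x ^ 2 + b * x * y + N₂ * c * y ^ 2) Δ = 1 := by
    refine gcd_eq_one_of_not_dvd h0 fun p hp => ?_
    by_cases h : P p
    · rw [prime_dvd_iff_of_modEq h0 hp (hn1 p hp h)]
      exact hP p hp h
    · rw [prime_dvd_iff_of_modEq h0 hp (hn2 p hp h)]
      exact hP' p hp h
  have hcond : GenusCharCond N Δ a b c := by
    refine ⟨⟨s, hQ⟩, ⟨η, ?_⟩, ?_⟩
    · rwa [hQ, Int.mul_ediv_cancel_left _ h0]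
    · refine gcd_eq_one_of_not_dvd h0 fun p hp hd => ?_
      have h3 : (p : ℤ) ∣ c := hd.trans (Int.gcd_dvd_right _ _)
      have h4 : (p : ℤ) ∣ a :=
        (hd.trans (Int.gcd_dvd_left _ _)).trans (Int.gcd_dvd_left _ _)
      by_cases h : P p
      · exact hP p hp h (Dvd.dvd.mul_left h3 _)
      · exact hP' p hp h (Dvd.dvd.mul_left h4 _)
  rw [hχ.2.2 a b c _ hcond hgcd ⟨N₁, N₂, x, y, hN, h₁, h₂, rfl⟩, kronecker_eq_prod hΔ hgcd]
  refine Finset.prod_congr rfl fun p hp => ?_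
  obtain ⟨hpp, hpΔ⟩ := mem_primeFactors_natAbs hp
  split_ifs with h
  · exact genusChi_congr hΔ hpp hpΔ (hn1 p hp h)
  · exact genusChi_congr hΔ hpp hpΔ (hn2 p hp h)

theorem genusProd_eq_intCast (Δ N C t β : ℤ) : genusProd Δ N C t β =
    ((∏ p ∈ Δ.natAbs.primeFactors, if ¬ (p : ℤ) ∣ β then genusChi Δ p β
      else genusChi Δ p (unitCoeff N C p * t) : ℤ) : ℂ) := by
  rw [genusProd]
  push_cast
  refine Finset.prod_congr rfl fun p _ => ?_
  rw [genusWeight]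
  split_ifs <;> rfl

theorem exists_represents_unitCoeff (Δ N r C : ℤ) :
    ∃ κ η : ℤ, ∀ p ∈ Δ.natAbs.primeFactors, N * κ ^ 2 + r * κ * η + C * η ^ 2 ≡
      unitCoeff N C p [ZMOD (p ^ Δ.natAbs.factorization p : ℕ)] := by
  obtain ⟨κ, hκ⟩ := exists_modEq_pow_factorization (D := Δ.natAbs)
    fun p => if (p : ℤ) ∣ N then 0 else 1
  obtain ⟨η, hη⟩ := exists_modEq_pow_factorization (D := Δ.natAbs)
    fun p => if (p : ℤ) ∣ N then 1 else 0
  refine ⟨κ, η, fun p hp => ?_⟩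
  have h1 := hκ p hp
  have h2 := hη p hp
  refine ((((h1.pow 2).mul_left N).add ((h1.mul_left r).mul h2)).add
    ((h2.pow 2).mul_left C)).trans ?_
  rw [unitCoeff]
  split_ifs <;> norm_num

theorem exists_factorization_coprime {Δ : ℤ} (hΔ : IsFundamentalDiscriminant Δ) {N : ℕ}
    (hN : 0 < N) {r C : ℤ} (hC : r ^ 2 - Δ = 4 * N * C) (β : ℤ) :
    ∃ N₁ N₂ : ℤ, N₁ * N₂ = N ∧ 0 < N₁ ∧ 0 < N₂ ∧ ∀ p ∈ Δ.natAbs.primeFactors,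
      (¬ (p : ℤ) ∣ β → ¬ (p : ℤ) ∣ N₂) ∧ ((p : ℤ) ∣ β → ¬ (p : ℤ) ∣ N₁) := by
  have hsub : {p ∈ Δ.natAbs.primeFactors | p ∣ N ∧ ¬ (p : ℤ) ∣ β} ⊆ N.primeFactors := by
    intro p hp
    rw [Finset.mem_filter] at hp
    exact Nat.mem_primeFactors.2 ⟨Nat.prime_of_mem_primeFactors hp.1, hp.2.1, hN.ne'⟩
  obtain ⟨N₂, h₂⟩ : (∏ p ∈ Δ.natAbs.primeFactors with p ∣ N ∧ ¬ (p : ℤ) ∣ β, p) ∣ N :=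
    (Finset.prod_dvd_prod_of_subset _ _ _ hsub).trans (Nat.prod_primeFactors_dvd N)
  have hpos : 0 < (∏ p ∈ Δ.natAbs.primeFactors with p ∣ N ∧ ¬ (p : ℤ) ∣ β, p) * N₂ := by
    rwa [← h₂]
  refine ⟨(∏ p ∈ Δ.natAbs.primeFactors with p ∣ N ∧ ¬ (p : ℤ) ∣ β, p : ℕ), N₂,
    by exact_mod_cast h₂.symm, by exact_mod_cast Nat.pos_of_mul_pos_right hpos,
    by exact_mod_cast Nat.pos_of_mul_pos_left hpos, fun p hp => ⟨fun h h' => ?_, fun h h' => ?_⟩⟩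
  · obtain ⟨hpp, hpΔ⟩ := mem_primeFactors_natAbs hp
    rw [Int.natCast_dvd_natCast] at h'
    have h3 : p ∈ {p ∈ Δ.natAbs.primeFactors | p ∣ N ∧ ¬ (p : ℤ) ∣ β} :=
      Finset.mem_filter.2 ⟨hp, h₂ ▸ Dvd.dvd.mul_left h' _, h⟩
    have h4 : p * p ∣ N := by
      conv_rhs => rw [h₂]
      exact mul_dvd_mul (Finset.dvd_prod_of_mem (fun p => p) h3) h'
    refine hΔ.not_sq_dvd hC hpp hpΔ (Dvd.dvd.mul_right ?_ _)
    rw [sq]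
    exact_mod_cast h4
  · rw [Int.natCast_dvd_natCast, (Nat.prime_of_mem_primeFactors hp).prime.dvd_finsetProd_iff] at h'
    obtain ⟨q, hq, hpq⟩ := h'
    rw [Finset.mem_filter] at hq
    rw [(Nat.prime_dvd_prime_iff_eq (Nat.prime_of_mem_primeFactors hp)
      (Nat.prime_of_mem_primeFactors hq.1)).1 hpq] at h
    exact hq.2.2 h

/-- Up to a constant, the generalized genus character is a product of local weights. -/
theorem IsGenusChar.exists_eq_genusProd {N : ℕ} (hN : 0 < N) {Δ : ℤ} {χ : ℤ → ℤ → ℤ → ℤ}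
    (hχ : IsGenusChar N Δ χ) (hΔ : IsFundamentalDiscriminant Δ) {r C : ℤ}
    (hC : r ^ 2 - Δ = 4 * N * C) :
    ∃ c₀ : ℤ, ∀ t β k η : ℤ, k ^ 2 - 4 * N * t * β ≡ Δ * η ^ 2 [ZMOD (4 * (N : ℤ) * Δ)] →
      (χ (-t) k (-β) : ℂ) = c₀ * genusProd Δ N C t β := by
  have h0 := hΔ.ne_zero
  obtain ⟨κ₀, η₀, hq₀⟩ := exists_represents_unitCoeff Δ N r C
  refine ⟨χ (-(N * κ₀ ^ 2 + r * κ₀ * η₀ + C * η₀ ^ 2)) (r * η₀ + 2 * N * κ₀) (-1),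
    fun t β k η h => ?_⟩
  obtain ⟨j, hj⟩ := h.symm.dvd
  have hQ : QD N (-t) k (-β) = Δ * (η ^ 2 + 4 * N * j) := by
    rw [QD]
    linear_combination hj
  rw [genusProd_eq_intCast, ← Int.cast_mul]
  congr 1
  by_cases hz : ∃ p ∈ Δ.natAbs.primeFactors, (p : ℤ) ∣ t ∧ (p : ℤ) ∣ β
  · obtain ⟨p, hp, ht, hβ⟩ := hz
    obtain ⟨hpp, hpΔ⟩ := mem_primeFactors_natAbs hp
    have hpi := Nat.prime_iff_prime_int.1 hpp
    rw [Finset.prod_eq_zero hp, mul_zero]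
    · refine hχ.2.1 _ _ _ fun hcond => ?_
      have hk : (p : ℤ) ∣ k := by
        refine hpi.dvd_of_dvd_pow (n := 2) ?_
        have : k ^ 2 = Δ * (η ^ 2 + 4 * N * j) + t * (4 * N * β) := by
          rw [QD] at hQ
          linear_combination hQ
        rw [this]
        exact dvd_add (Dvd.dvd.mul_right hpΔ _) (Dvd.dvd.mul_right ht _)
      have := Int.dvd_coe_gcd (Int.dvd_coe_gcd (Int.dvd_coe_gcd ((dvd_neg).2 ht) hk)
        ((dvd_neg).2 hβ)) hpΔ
      rw [hcond.2.2] at this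
      exact hpi.not_isUnit (isUnit_of_dvd_one (by exact_mod_cast this))
    · rw [if_neg (not_not.2 hβ)]
      exact genusChi_eq_zero Δ hpp (Dvd.dvd.mul_left ht _)
  · push Not at hz
    obtain ⟨N₁, N₂, hNN, h₁, h₂, hc⟩ := exists_factorization_coprime hΔ hN hC β
    have hu : ∀ p ∈ Δ.natAbs.primeFactors,
        ¬ (p : ℤ) ∣ N * κ₀ ^ 2 + r * κ₀ * η₀ + C * η₀ ^ 2 := fun p hp => by
      obtain ⟨hpp, hpΔ⟩ := mem_primeFactors_natAbs hp
      rw [prime_dvd_iff_of_modEq h0 hp (hq₀ p hp)]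
      exact unitCoeff_not_dvd hΔ hC hpp hpΔ
    have hmul : ∀ p ∈ Δ.natAbs.primeFactors, ∀ a b : ℤ, ¬ (p : ℤ) ∣ a → ¬ (p : ℤ) ∣ b →
        ¬ (p : ℤ) ∣ a * b := fun p hp a b ha hb hab =>
      ((Nat.prime_iff_prime_int.1 (Nat.prime_of_mem_primeFactors hp)).dvd_or_dvd hab).elim ha hb
    rw [hχ.eq_prod hΔ hQ (η := η) 
        (Int.modEq_iff_dvd.2 ⟨-j, by ring⟩) hNN h₁ h₂
        (fun p => ¬ (p : ℤ) ∣ β)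
        (fun p hp h => hmul p hp _ _ ((hc p hp).1 h) (by rwa [dvd_neg]))
        (fun p hp h => hmul p hp _ _ ((hc p hp).2 (not_not.1 h))
          (by rw [dvd_neg]; exact fun h' => hz p hp h' (not_not.1 h))),
      hχ.eq_prod hΔ (s := η₀ ^ 2) (η := η₀) (by rw [QD]; linear_combination η₀ ^ 2 * hC)
        rfl hNN h₁ h₂ (fun p => ¬ (p : ℤ) ∣ β)
        (fun p hp h => hmul p hp _ _ ((hc p hp).1 h) (by
          rw [dvd_neg]
          exact (Nat.prime_iff_prime_int.1 (Nat.prime_of_mem_primeFactors hp)).not_dvd_one))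
        (fun p hp h => hmul p hp _ _ ((hc p hp).2 (not_not.1 h)) (by rw [dvd_neg]; exact hu p hp)),
      ← Finset.prod_mul_distrib]
    refine Finset.prod_congr rfl fun p hp => ?_
    obtain ⟨hpp, hpΔ⟩ := mem_primeFactors_natAbs hp
    split_ifs with h
    · have e1 : N₁ * -t = N₁ * -1 * t := by ring
      have e2 : N₁ * -(N * κ₀ ^ 2 + r * κ₀ * η₀ + C * η₀ ^ 2) =
          N₁ * -1 * (N * κ₀ ^ 2 + r * κ₀ * η₀ + C * η₀ ^ 2) := by ring
      rw [e1, e2, genusChi_mul Δ p (N₁ * -1), genusChi_mul Δ p (N₁ * -1),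
        genusChi_congr hΔ hpp hpΔ (hq₀ p hp), genusChi_mul Δ p (unitCoeff _ _ _)]
      linear_combination (-genusChi Δ p (N₁ * -1) * genusChi Δ p t) *
        genusChi_mul_self Δ hpp (unitCoeff_not_dvd hΔ hC hpp hpΔ)
    · rw [← genusChi_mul]
      congr 1
      ring

/-- The sum over `t` modulo `D` attached to the product of local weights, as a function of the
value `n` of the norm form `[N, r, C]`. -/
def genusPhi (Δ N C : ℤ) [NeZero Δ.natAbs] (α β n : ZMod Δ.natAbs) : ℂ :=
  ∑ t : ZMod Δ.natAbs, (if t * β = n then genusProd Δ N C t.cast β.cast else 0) *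
    ZMod.stdAddChar (-(α * t))

theorem intCast_cast_modEq (Δ : ℤ) [NeZero Δ.natAbs] (a : ℤ) :
    ((a : ZMod Δ.natAbs).cast : ℤ) ≡ a [ZMOD Δ] := by
  have h := (ZMod.intCast_eq_intCast_iff_dvd_sub ((a : ZMod Δ.natAbs).cast) a Δ.natAbs).1
    (by simp)
  exact Int.modEq_iff_dvd.2 (Int.natAbs_dvd.1 h)

theorem weight_eq_genusPhi {N : ℕ} (hN : 0 < N) {Δ r C : ℤ} {χ : ℤ → ℤ → ℤ → ℤ}
    (hΔ : IsFundamentalDiscriminant Δ) (hC : r ^ 2 - Δ = 4 * N * C) [NeZero Δ.natAbs] {c₀ : ℤ}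
    (hc : ∀ t β k η : ℤ, k ^ 2 - 4 * N * t * β ≡ Δ * η ^ 2 [ZMOD (4 * (N : ℤ) * Δ)] →
      (χ (-t) k (-β) : ℂ) = c₀ * genusProd Δ N C t β) (α β h k : ℤ) :
    weight N Δ r χ α β h k = c₀ * normWeight N Δ r (genusPhi Δ N C α β) h k := by
  by_cases hk : k ≡ r * h [ZMOD (2 * (N : ℤ))]
  · obtain ⟨κ, hκ⟩ := hk.symm.dvd
    obtain rfl : k = r * h + 2 * N * κ := by linarith
    rw [normWeight_eq hN hC, weight, if_pos hk, genusPhi, ← sum_range_intCast (D := Δ.natAbs),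
      Finset.mul_sum]
    refine Finset.sum_congr rfl fun t _ => ?_
    have hiff : (r * h + 2 * N * κ) ^ 2 - 4 * N * t * β ≡ Δ * h ^ 2 [ZMOD (4 * (N : ℤ) * Δ)] ↔
        ((t : ℤ) : ZMod Δ.natAbs) * β =
          ((N * κ ^ 2 + r * κ * h + C * h ^ 2 : ℤ) : ZMod Δ.natAbs) := by
      rw [← Int.cast_mul, ZMod.intCast_eq_intCast_iff_dvd_sub, Int.natAbs_dvd,
        Int.modEq_comm, Int.modEq_iff_dvd,
        show (r * h + 2 * N * κ) ^ 2 - 4 * N * t * β - Δ * h ^ 2 =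
          4 * N * (N * κ ^ 2 + r * κ * h + C * h ^ 2 - t * β) by linear_combination h ^ 2 * hC,
        Int.mul_dvd_mul_iff_left (by positivity)]
    by_cases h1 : (r * h + 2 * N * κ) ^ 2 - 4 * N * t * β ≡ Δ * h ^ 2 [ZMOD (4 * (N : ℤ) * Δ)]
    · rw [if_pos h1, if_pos (hiff.1 h1), hc t β _ h h1, ← Int.cast_mul,
        show (-((α * t : ℤ) : ZMod Δ.natAbs)) = ((-(α * t) : ℤ) : ZMod Δ.natAbs) by push_cast; rfl,
        stdAddChar_intCast, genusProd_congr hΔ N C (intCast_cast_modEq Δ t)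
          (intCast_cast_modEq Δ β)]
      push_cast
      ring_nf
    · rw [if_neg h1, if_neg (mt hiff.2 h1)]
      simp
  · rw [weight, normWeight, if_neg hk, if_neg hk, mul_zero]

theorem fourierPer_weight {N : ℕ} (hN : 0 < N) {Δ r : ℤ} {χ : ℤ → ℤ → ℤ → ℤ}
    (hΔ : IsFundamentalDiscriminant Δ) (hr : Δ ≡ r ^ 2 [ZMOD (4 * (N : ℤ))])
    (hχ : IsGenusChar N Δ χ) (α β h k' : ℤ) :
    fourierPer (2 * N * Δ.natAbs) (weight N Δ r χ (-β) α h) k' =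
      e ((1 - (Δ.sign : ℂ)) / 8) * (Real.sqrt Δ.natAbs : ℂ) *
        ∑ j ∈ Finset.range (2 * N), e (-(Δ.sign : ℂ) * h * j / (2 * N)) *
          weight N Δ r χ α β j k' := by
  obtain ⟨C, hC⟩ := hr.dvd
  have : NeZero Δ.natAbs := ⟨Int.natAbs_ne_zero.2 hΔ.ne_zero⟩
  obtain ⟨c₀, hc⟩ := hχ.exists_eq_genusProd hN hΔ hC
  have hloc := fourierPer_normWeight hN hΔ.ne_zero rfl hC
    (genusPhi Δ N C (-(β : ZMod Δ.natAbs)) α) (genusPhi Δ N C α β) (fun x' y' => by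
      have h1 := fourierSelfDual_genusProd hΔ hC ZMod.stdAddChar
        (ZMod.isPrimitive_stdAddChar _) (α : ZMod Δ.natAbs) β x' y'
      push_cast at h1
      refine Eq.trans ?_ h1
      refine Finset.sum_congr rfl fun x _ => Finset.sum_congr rfl fun y _ => ?_
      rw [genusPhi, Finset.sum_mul]
      refine Finset.sum_congr rfl fun t _ => ?_
      rw [mul_assoc, ← AddChar.map_add_eq_mul]
      congr 2
      ring) h k'
  have e1 : ∀ a b j, weight N Δ r χ a b j =
      fun k => c₀ * normWeight N Δ r (genusPhi Δ N C a b) j k := fun a b j =>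
    funext fun k => weight_eq_genusPhi hN hΔ hC hc a b j k
  simp only [e1, fourierPer, mul_assoc, mul_left_comm _ (c₀ : ℂ), ← Finset.mul_sum] at hloc ⊢
  push_cast at hloc ⊢
  rw [hloc]

/-- Bruinier–Ono, Theorem 4.5: Let `Δ` be a fundamental discriminant and
`r ∈ ℤ` with `Δ ≡ r² (mod 4N)`.  For `(M, φ) ∈ Mp₂(ℤ)` with `M = [[a,b],[c,d]]`, the
`ℂ[K'/K]`-valued function `Ξ(τ, μ, α, β) = ∑_h ξ_h(τ, μ, α, β) 𝔢_h` satisfies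
`Ξ(Mτ, μ, aα + bβ, cα + dβ) = φ(τ) ρ̃_K(M, φ) Ξ(τ, μ, α, β)`, where `ρ̃_K = ρ_K` if
`Δ > 0` and `ρ̃_K = ρ̄_K` if `Δ < 0`.  As in Statement 6, `ρ̃_K` is encoded by any
assignment `ρ` of linear endomorphisms of `ℂ[K'/K] = (ℤ/2Nℤ → ℂ)` compatible with the
metaplectic group law and taking the prescribed values of `ρ_K` (resp. `ρ̄_K`) on the
generators `T` and `S`. -/
theorem xi_transformation
    (N : ℕ) (hN : 0 < N) (Δ : ℤ) (hΔ : IsFundamentalDiscriminant Δ)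
    (r : ℤ) (hr : Δ ≡ r ^ 2 [ZMOD (4 * (N : ℤ))])
    (χ : ℤ → ℤ → ℤ → ℤ) (hχ : IsGenusChar N Δ χ)
    (ρ : Mp2 → (ZMod (2 * N) → ℂ) →ₗ[ℂ] (ZMod (2 * N) → ℂ))
    (hρmul : ∀ γ δ ζ : Mp2, ζ.M = γ.M * δ.M →
      (∀ τ : UpperHalfPlane, ζ.φ τ = γ.φ (δ.M • τ) * δ.φ τ) →
      ρ ζ = (ρ γ).comp (ρ δ))
    (hρT : ∀ γ : Mp2, γ.M = ModularGroup.T → (∀ τ, γ.φ τ = 1) →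
      ∀ (v : ZMod (2 * N) → ℂ) (h : ZMod (2 * N)),
        ρ γ v h = e ((Δ.sign : ℂ) * (h.val : ℂ) ^ 2 / (4 * (N : ℂ))) * v h)
    (hρS : ∀ γ : Mp2, γ.M = ModularGroup.S →
      (∀ τ : UpperHalfPlane, γ.φ τ = (τ : ℂ) ^ (1/2 : ℂ)) →
      ∀ (v : ZMod (2 * N) → ℂ) (h : ZMod (2 * N)),
        ρ γ v h = e (-(Δ.sign : ℂ) / 8) / (Real.sqrt (2 * N) : ℂ) *
          ∑ j ∈ Finset.range (2 * N),
            e (-(Δ.sign : ℂ) * (h.val : ℂ) * (j : ℂ) / (2 * (N : ℂ))) * v (j : ZMod (2 * N))) :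
    ∀ (γ : Mp2) (τ : UpperHalfPlane) (μ : ℝ) (α β : ℤ),
      (fun h => xiComp N Δ r χ μ
          (γ.M.1 0 0 * α + γ.M.1 0 1 * β) (γ.M.1 1 0 * α + γ.M.1 1 1 * β) h (γ.M • τ)) =
        γ.φ τ • ρ γ (fun h => xiComp N Δ r χ μ α β h τ) := by
  exact xi_transformation_of_fourier N hN Δ hΔ.ne_zero r χ hχ
    (fourierPer_weight hN hΔ hr hχ) ρ hρmul hρT hρS
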